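/- arXiv:2312.05931 — 10 statements merged into one kernel-verified Lean document; each statement's English description precedes it below -/
import Mathlib

section
/- Fix the D₄⁺ normal form f with a > 0, with unit normal ν near the origin, and let γ̂₁(u) = f(u,0). For u ≠ 0 small, the singular curvature along the u-axis is κ_s(u) = sgn(u)·det(γ̂₁′(u), γ̂₁″(u), ν(u,0))/‖γ̂₁′(u)‖³. Then lim_{u→0, u≠0} u·κ_s(u) = 3·b₁(0)/(4(1+a²)^{3/2}). -/
open Real Filter Topology

noncomputable section

/-- Euclidean inner product on `ℝ³` (realized as `Fin 3 → ℝ`). -/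
def dot3 (x y : Fin 3 → ℝ) : ℝ := x 0 * y 0 + x 1 * y 1 + x 2 * y 2

/-- Euclidean norm on `ℝ³`. -/
def norm3 (x : Fin 3 → ℝ) : ℝ := Real.sqrt (dot3 x x)

/-- Cross product on `ℝ³`. -/
def cross3 (x y : Fin 3 → ℝ) : Fin 3 → ℝ :=
  ![x 1 * y 2 - x 2 * y 1, x 2 * y 0 - x 0 * y 2, x 0 * y 1 - x 1 * y 0]

/-- Determinant of the `3 × 3` matrix whose columns are `x`, `y`, `z`. -/
def det3 (x y z : Fin 3 → ℝ) : ℝ := Matrix.det (Matrix.of ![x, y, z]).transpose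

/-- Partial derivative with respect to the first variable. -/
def pd1 {E : Type*} [NormedAddCommGroup E] [NormedSpace ℝ E]
    (g : ℝ × ℝ → E) (p : ℝ × ℝ) : E := deriv (fun u => g (u, p.2)) p.1

/-- Partial derivative with respect to the second variable. -/
def pd2 {E : Type*} [NormedAddCommGroup E] [NormedSpace ℝ E]
    (g : ℝ × ℝ → E) (p : ℝ × ℝ) : E := deriv (fun v => g (p.1, v)) p.2

/-- The building block `u³·g₁(u) + u²v²·g₂(u,v) + v³·g₃(v)`. -/
def BC (g1 g3 : ℝ → ℝ) (g2 : ℝ × ℝ → ℝ) (p : ℝ × ℝ) : ℝ :=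
  p.1 ^ 3 * g1 p.1 + p.1 ^ 2 * p.2 ^ 2 * g2 p + p.2 ^ 3 * g3 p.2

/-- The D₄⁺ normal form
`f(u,v) = (u² − v², a(u² + v²) + b(u,v), c(u,v))`. -/
def NF (a : ℝ) (b1 b3 c1 c3 : ℝ → ℝ) (b2 c2 : ℝ × ℝ → ℝ) (p : ℝ × ℝ) : Fin 3 → ℝ :=
  ![p.1 ^ 2 - p.2 ^ 2, a * (p.1 ^ 2 + p.2 ^ 2) + BC b1 b3 b2 p, BC c1 c3 c2 p]

/-- The vector field `φ₁` with `∂f/∂u = u·φ₁`. -/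
def Phi1 (a : ℝ) (b1 c1 : ℝ → ℝ) (b2 c2 : ℝ × ℝ → ℝ) (p : ℝ × ℝ) : Fin 3 → ℝ :=
  ![2, 2 * a + 3 * p.1 * b1 p.1 + p.1 ^ 2 * deriv b1 p.1 + 2 * p.2 ^ 2 * b2 p +
      p.1 * p.2 ^ 2 * pd1 b2 p,
    3 * p.1 * c1 p.1 + p.1 ^ 2 * deriv c1 p.1 + 2 * p.2 ^ 2 * c2 p +
      p.1 * p.2 ^ 2 * pd1 c2 p]

/-- The vector field `φ₂` with `∂f/∂v = v·φ₂`. -/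
def Phi2 (a : ℝ) (b3 c3 : ℝ → ℝ) (b2 c2 : ℝ × ℝ → ℝ) (p : ℝ × ℝ) : Fin 3 → ℝ :=
  ![-2, 2 * a + 3 * p.2 * b3 p.2 + p.2 ^ 2 * deriv b3 p.2 + 2 * p.1 ^ 2 * b2 p +
      p.1 ^ 2 * p.2 * pd2 b2 p,
    3 * p.2 * c3 p.2 + p.2 ^ 2 * deriv c3 p.2 + 2 * p.1 ^ 2 * c2 p +
      p.1 ^ 2 * p.2 * pd2 c2 p]

/-- The unit normal `ν = (φ₁ × φ₂)/‖φ₁ × φ₂‖` of the D₄⁺ normal form. -/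
def nuNF (a : ℝ) (b1 b3 c1 c3 : ℝ → ℝ) (b2 c2 : ℝ × ℝ → ℝ) (p : ℝ × ℝ) : Fin 3 → ℝ :=
  (norm3 (cross3 (Phi1 a b1 c1 b2 c2 p) (Phi2 a b3 c3 b2 c2 p)))⁻¹ •
    cross3 (Phi1 a b1 c1 b2 c2 p) (Phi2 a b3 c3 b2 c2 p)

/-- The distance squared function `d_x(u,v) = ‖x − f(u,v)‖²/2`. -/
def dsq (f : ℝ × ℝ → Fin 3 → ℝ) (x : Fin 3 → ℝ) (p : ℝ × ℝ) : ℝ :=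
  dot3 (x - f p) (x - f p) / 2

/-- The singular curvature along the `u`-axis of the D₄⁺ normal form. -/
def kapS (a : ℝ) (b1 b3 c1 c3 : ℝ → ℝ) (b2 c2 : ℝ × ℝ → ℝ) (u : ℝ) : ℝ :=
  Real.sign u *
    det3 (deriv (fun t => NF a b1 b3 c1 c3 b2 c2 (t, 0)) u)
      (deriv (deriv (fun t => NF a b1 b3 c1 c3 b2 c2 (t, 0))) u)
      (nuNF a b1 b3 c1 c3 b2 c2 (u, 0)) /
    norm3 (deriv (fun t => NF a b1 b3 c1 c3 b2 c2 (t, 0)) u) ^ 3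

theorem aux_d1 (a : ℝ) (b1 b3 c1 c3 : ℝ → ℝ) (b2 c2 : ℝ × ℝ → ℝ)
    (hb1 : ContDiff ℝ (⊤ : ℕ∞) b1) (hc1s : ContDiff ℝ (⊤ : ℕ∞) c1) :
    deriv (fun t => NF a b1 b3 c1 c3 b2 c2 (t, 0)) = fun u =>
      ![2 * u, 2 * a * u + 3 * u ^ 2 * b1 u + u ^ 3 * deriv b1 u,
        3 * u ^ 2 * c1 u + u ^ 3 * deriv c1 u] := by
  have key : ∀ g : ℝ → ℝ, ContDiff ℝ (⊤ : ℕ∞) g → ∀ u, HasDerivAt (fun t => t ^ 3 * g t)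
      (3 * u ^ 2 * g u + u ^ 3 * deriv g u) u := by
    intro g hg u
    have h := (hasDerivAt_pow 3 u).mul ((hg.differentiable (by simp)) u).hasDerivAt
    exact h.congr_deriv (by norm_num)
  funext u
  apply HasDerivAt.deriv
  rw [hasDerivAt_pi]
  intro i
  fin_cases i
  · simpa [NF, BC] using hasDerivAt_pow 2 u
  · have h := ((hasDerivAt_pow 2 u).const_mul a).add (key b1 hb1 u)
    have h2 := h.congr_deriv (g' := 2 * a * u + 3 * u ^ 2 * b1 u + u ^ 3 * deriv b1 u)
      (by push_cast; ring)
    refine h2.congr_of_eventuallyEq (Eventually.of_forall fun t => ?_)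
    simp [NF, BC]
  · refine (key c1 hc1s u).congr_of_eventuallyEq (Eventually.of_forall fun t => ?_)
    simp [NF, BC]

theorem aux_d2 (a : ℝ) (b1 c1 : ℝ → ℝ)
    (hb1 : ContDiff ℝ (⊤ : ℕ∞) b1) (hc1s : ContDiff ℝ (⊤ : ℕ∞) c1) :
    deriv (fun u : ℝ =>
      ![2 * u, 2 * a * u + 3 * u ^ 2 * b1 u + u ^ 3 * deriv b1 u,
        3 * u ^ 2 * c1 u + u ^ 3 * deriv c1 u]) = fun u =>
      ![2, 2 * a + (6 * u * b1 u + 6 * u ^ 2 * deriv b1 u + u ^ 3 * deriv (deriv b1) u),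
        6 * u * c1 u + 6 * u ^ 2 * deriv c1 u + u ^ 3 * deriv (deriv c1) u] := by
  have key : ∀ g : ℝ → ℝ, ContDiff ℝ (⊤ : ℕ∞) g → ∀ u,
      HasDerivAt (fun t => 3 * t ^ 2 * g t + t ^ 3 * deriv g t)
      (6 * u * g u + 6 * u ^ 2 * deriv g u + u ^ 3 * deriv (deriv g) u) u := by
    intro g hg u
    have hg' : ContDiff ℝ (⊤ : ℕ∞) (deriv g) := (contDiff_infty_iff_deriv.1 hg).2
    have h := (((hasDerivAt_pow 2 u).const_mul 3).mul
      ((hg.differentiable (by simp)) u).hasDerivAt).add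
      ((hasDerivAt_pow 3 u).mul ((hg'.differentiable (by simp)) u).hasDerivAt)
    exact h.congr_deriv (by push_cast; ring)
  funext u
  apply HasDerivAt.deriv
  rw [hasDerivAt_pi]
  intro i
  fin_cases i
  · simpa using (hasDerivAt_id u).const_mul 2
  · have h := ((hasDerivAt_id u).const_mul (2 * a)).add (key b1 hb1 u)
    have h2 := h.congr_deriv (g' := 2 * a + (6 * u * b1 u + 6 * u ^ 2 * deriv b1 u + u ^ 3 * deriv (deriv b1) u))
      (by ring)
    refine h2.congr_of_eventuallyEq (Eventually.of_forall fun t => ?_)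
    simp [add_assoc]
  · exact key c1 hc1s u

theorem aux_det (x y z : Fin 3 → ℝ) : det3 x y z =
    (x 1 * y 2 - x 2 * y 1) * z 0 + (x 2 * y 0 - x 0 * y 2) * z 1
      + (x 0 * y 1 - x 1 * y 0) * z 2 := by
  simp [det3, Matrix.det_fin_three]
  ring

theorem aux_main (u B C B' C' : ℝ) (z : Fin 3 → ℝ) (hu : u ≠ 0) :
    u * (Real.sign u * det3 ![2 * u, u * B, u * C] ![2, B + u * B', C + u * C'] z /
      norm3 ![2 * u, u * B, u * C] ^ 3) =
    ((B * C' - C * B') * z 0 - 2 * C' * z 1 + 2 * B' * z 2) / √(4 + B ^ 2 + C ^ 2) ^ 3 := by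
  have hn : norm3 ![2 * u, u * B, u * C] = |u| * √(4 + B ^ 2 + C ^ 2) := by
    rw [norm3, ← Real.sqrt_sq_eq_abs, ← Real.sqrt_mul (sq_nonneg u)]
    congr 1
    simp [dot3]; ring
  have hs : √(4 + B ^ 2 + C ^ 2) ≠ 0 := by positivity
  rw [hn, aux_det]
  simp
  rcases lt_or_gt_of_ne hu with h | h
  · rw [abs_of_neg h, Real.sign_of_neg h]; field_simp; ring
  · rw [abs_of_pos h, Real.sign_of_pos h]; field_simp; ring

/-- asymptotics of the singular curvature along the `u`-axis. -/
theorem stmt_8     (a : ℝ) (b1 b3 c1 c3 : ℝ → ℝ) (b2 c2 : ℝ × ℝ → ℝ)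
    (hb1 : ContDiff ℝ (⊤ : ℕ∞) b1) (hb3 : ContDiff ℝ (⊤ : ℕ∞) b3)
    (hc1s : ContDiff ℝ (⊤ : ℕ∞) c1) (hc3s : ContDiff ℝ (⊤ : ℕ∞) c3)
    (hb2 : ContDiff ℝ (⊤ : ℕ∞) b2) (hc2 : ContDiff ℝ (⊤ : ℕ∞) c2)
    (ha : 0 < a) :
    Filter.Tendsto (fun u : ℝ => u * kapS a b1 b3 c1 c3 b2 c2 u) (𝓝[≠] (0 : ℝ))
      (𝓝 (3 * b1 0 / (4 * Real.sqrt (1 + a ^ 2) ^ 3))) := by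
  have hb1' : ContDiff ℝ (⊤ : ℕ∞) (deriv b1) := (contDiff_infty_iff_deriv.1 hb1).2
  have hc1' : ContDiff ℝ (⊤ : ℕ∞) (deriv c1) := (contDiff_infty_iff_deriv.1 hc1s).2
  have hb1'' : ContDiff ℝ (⊤ : ℕ∞) (deriv (deriv b1)) := (contDiff_infty_iff_deriv.1 hb1').2
  have hc1'' : ContDiff ℝ (⊤ : ℕ∞) (deriv (deriv c1)) := (contDiff_infty_iff_deriv.1 hc1').2
  have k1 := hb1.continuous
  have k2 := hc1s.continuous
  have k3 := hb1'.continuous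
  have k4 := hc1'.continuous
  have k5 := hb1''.continuous
  have k6 := hc1''.continuous
  have k7 := hb2.continuous
  have k8 := hc2.continuous
  obtain ⟨B, hB⟩ : ∃ B : ℝ → ℝ, B = fun u => 2 * a + 3 * u * b1 u + u ^ 2 * deriv b1 u := ⟨_, rfl⟩
  obtain ⟨C, hC⟩ : ∃ C : ℝ → ℝ, C = fun u => 3 * u * c1 u + u ^ 2 * deriv c1 u := ⟨_, rfl⟩
  obtain ⟨B', hB'⟩ : ∃ B : ℝ → ℝ, B = fun u => 3 * b1 u + 5 * u * deriv b1 u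
    + u ^ 2 * deriv (deriv b1) u := ⟨_, rfl⟩
  obtain ⟨C', hC'⟩ : ∃ B : ℝ → ℝ, B = fun u => 3 * c1 u + 5 * u * deriv c1 u
    + u ^ 2 * deriv (deriv c1) u := ⟨_, rfl⟩
  obtain ⟨D, hD⟩ : ∃ D : ℝ → ℝ, D = fun u => 2 * a + 2 * u ^ 2 * b2 (u, 0) := ⟨_, rfl⟩
  obtain ⟨E, hE⟩ : ∃ E : ℝ → ℝ, E = fun u => 2 * u ^ 2 * c2 (u, 0) := ⟨_, rfl⟩
  have cB : Continuous B := by rw [hB]; fun_prop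
  have cC : Continuous C := by rw [hC]; fun_prop
  have cB' : Continuous B' := by rw [hB']; fun_prop
  have cC' : Continuous C' := by rw [hC']; fun_prop
  have cD : Continuous D := by rw [hD]; fun_prop
  have cE : Continuous E := by rw [hE]; fun_prop
  have hnu : ∀ u, nuNF a b1 b3 c1 c3 b2 c2 (u, 0) =
      (norm3 (cross3 ![2, B u, C u] ![-2, D u, E u]))⁻¹ •
        cross3 ![2, B u, C u] ![-2, D u, E u] := by
    intro u
    simp [nuNF, Phi1, Phi2, hB, hC, hD, hE]
  have heq : ∀ u : ℝ, u ≠ 0 → u * kapS a b1 b3 c1 c3 b2 c2 u =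
      ((B u * C' u - C u * B' u) * (nuNF a b1 b3 c1 c3 b2 c2 (u, 0)) 0
        - 2 * C' u * (nuNF a b1 b3 c1 c3 b2 c2 (u, 0)) 1
        + 2 * B' u * (nuNF a b1 b3 c1 c3 b2 c2 (u, 0)) 2) / √(4 + B u ^ 2 + C u ^ 2) ^ 3 := by
    intro u hu
    rw [← aux_main u (B u) (C u) (B' u) (C' u) _ hu, kapS, aux_d1 a b1 b3 c1 c3 b2 c2 hb1 hc1s,
      aux_d2 a b1 c1 hb1 hc1s]
    have e1 : ![2 * u, 2 * a * u + 3 * u ^ 2 * b1 u + u ^ 3 * deriv b1 u,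
        3 * u ^ 2 * c1 u + u ^ 3 * deriv c1 u] = ![2 * u, u * B u, u * C u] := by
      congr 1; simp only [hB, hC]; congr 1
      · ring
      · congr 1; ring
    have e2 : ![2, 2 * a + (6 * u * b1 u + 6 * u ^ 2 * deriv b1 u + u ^ 3 * deriv (deriv b1) u),
        6 * u * c1 u + 6 * u ^ 2 * deriv c1 u + u ^ 3 * deriv (deriv c1) u]
        = ![2, B u + u * B' u, C u + u * C' u] := by
      congr 1; simp only [hB, hC, hB', hC']; congr 1
      · ring
      · congr 1; ring
    simp only [e1, e2]
  have B0 : B 0 = 2 * a := by simp [hB]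
  have C0 : C 0 = 0 := by simp [hC]
  have D0 : D 0 = 2 * a := by simp [hD]
  have E0 : E 0 = 0 := by simp [hE]
  have B'0 : B' 0 = 3 * b1 0 := by simp [hB']
  have cX : ∀ i, Continuous fun u => cross3 ![2, B u, C u] ![-2, D u, E u] i := by
    intro i
    fin_cases i <;> simp [cross3] <;> fun_prop
  have n0 : norm3 (cross3 ![2, B 0, C 0] ![-2, D 0, E 0]) = 8 * a := by
    rw [norm3, Real.sqrt_eq_iff_mul_self_eq_of_pos (by positivity)]
    simp [dot3, cross3, B0, C0, D0, E0]; ring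
  have cN : Continuous fun u => norm3 (cross3 ![2, B u, C u] ![-2, D u, E u]) := by
    have h0 := cX 0
    have h1 := cX 1
    have h2 := cX 2
    unfold norm3 dot3
    fun_prop
  have cnu : ∀ i, ContinuousAt (fun u => nuNF a b1 b3 c1 c3 b2 c2 (u, 0) i) 0 := by
    intro i
    simp only [hnu, Pi.smul_apply, smul_eq_mul]
    refine (cN.continuousAt.inv₀ ?_).mul (cX i).continuousAt
    rw [n0]; positivity
  have cS : Continuous fun u => √(4 + B u ^ 2 + C u ^ 2) ^ 3 := by fun_prop
  have cF : ContinuousAt (fun u => ((B u * C' u - C u * B' u) * (nuNF a b1 b3 c1 c3 b2 c2 (u, 0)) 0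
        - 2 * C' u * (nuNF a b1 b3 c1 c3 b2 c2 (u, 0)) 1
        + 2 * B' u * (nuNF a b1 b3 c1 c3 b2 c2 (u, 0)) 2) / √(4 + B u ^ 2 + C u ^ 2) ^ 3) 0 := by
    have h0 := cnu 0
    have h1 := cnu 1
    have h2 := cnu 2
    refine ContinuousAt.div ?_ cS.continuousAt (by positivity)
    exact (((cB.mul cC').sub (cC.mul cB')).continuousAt.mul h0).sub
      ((continuous_const.mul cC').continuousAt.mul h1) |>.add
      ((continuous_const.mul cB').continuousAt.mul h2)
  have hlim := cF.tendsto.mono_left (nhdsWithin_le_nhds (s := {0}ᶜ))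
  have hsq : √(4 + (2 * a) ^ 2 + 0 ^ 2) = 2 * √(1 + a ^ 2) := by
    rw [show (4 + (2 * a) ^ 2 + 0 ^ 2 : ℝ) = 2 ^ 2 * (1 + a ^ 2) by ring,
      Real.sqrt_mul (by positivity), Real.sqrt_sq (by positivity)]
  have hval : ((B 0 * C' 0 - C 0 * B' 0) * (nuNF a b1 b3 c1 c3 b2 c2 (0, 0)) 0
        - 2 * C' 0 * (nuNF a b1 b3 c1 c3 b2 c2 (0, 0)) 1
        + 2 * B' 0 * (nuNF a b1 b3 c1 c3 b2 c2 (0, 0)) 2) / √(4 + B 0 ^ 2 + C 0 ^ 2) ^ 3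
      = 3 * b1 0 / (4 * Real.sqrt (1 + a ^ 2) ^ 3) := by
    have hs : √(1 + a ^ 2) ≠ 0 := by positivity
    rw [hnu, n0, B0, C0, D0, E0, B'0, hsq]
    simp [cross3]
    field_simp
    ring
  rw [hval] at hlim
  refine hlim.congr' ?_
  filter_upwards [self_mem_nhdsWithin] with u hu
  exact (heq u hu).symm
end
end

section
/- Fix the D₄⁺ normal form f with a > 0, with unit normal ν near the origin, and let γ̂₁(u) = f(u,0). For u ≠ 0 small, the limiting normal curvature along the u-axis is κ_ν(u) = ⟨γ̂₁″(u), ν(u,0)⟩/‖γ̂₁′(u)‖². Then lim_{u→0, u≠0} u·κ_ν(u) = 3·c₁(0)/(4(1+a²)). -/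
open Real Filter Topology

noncomputable section

/-- The limiting normal curvature along the `u`-axis of the D₄⁺ normal form. -/
def kapN (a : ℝ) (b1 b3 c1 c3 : ℝ → ℝ) (b2 c2 : ℝ × ℝ → ℝ) (u : ℝ) : ℝ :=
  dot3 (deriv (deriv (fun t => NF a b1 b3 c1 c3 b2 c2 (t, 0))) u)
      (nuNF a b1 b3 c1 c3 b2 c2 (u, 0)) /
    norm3 (deriv (fun t => NF a b1 b3 c1 c3 b2 c2 (t, 0)) u) ^ 2

lemma aux_d1_s9 (g : ℝ → ℝ) (hg : ContDiff ℝ (⊤ : ℕ∞) g) (u : ℝ) :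
    HasDerivAt (fun t => t ^ 3 * g t) (u * (3 * u * g u + u ^ 2 * deriv g u)) u := by
  have h : HasDerivAt g (deriv g u) u :=
    (hg.differentiable (by simp)).differentiableAt.hasDerivAt
  refine ((hasDerivAt_pow 3 u).mul h).congr_deriv ?_
  norm_num
  ring

lemma aux_cd (g : ℝ → ℝ) (hg : ContDiff ℝ (⊤ : ℕ∞) g) : ContDiff ℝ (⊤ : ℕ∞) (deriv g) :=
  (contDiff_infty_iff_deriv.1 hg).2

lemma aux_d2_s9 (g : ℝ → ℝ) (hg : ContDiff ℝ (⊤ : ℕ∞) g) (u : ℝ) :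
    HasDerivAt (fun t => 3 * t * g t + t ^ 2 * deriv g t)
      (3 * g u + 5 * u * deriv g u + u ^ 2 * deriv (deriv g) u) u := by
  have h : HasDerivAt g (deriv g u) u :=
    (hg.differentiable (by simp)).differentiableAt.hasDerivAt
  have h2 : HasDerivAt (deriv g) (deriv (deriv g) u) u :=
    ((aux_cd g hg).differentiable (by simp)).differentiableAt.hasDerivAt
  refine ((((hasDerivAt_id u).const_mul 3).mul h).add ((hasDerivAt_pow 2 u).mul h2)).congr_deriv ?_
  norm_num
  ring

lemma aux_vec (f1 f2 f3 : ℝ → ℝ) (d1 d2 d3 u : ℝ) (h1 : HasDerivAt f1 d1 u)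
    (h2 : HasDerivAt f2 d2 u) (h3 : HasDerivAt f3 d3 u) :
    HasDerivAt (fun t => (![f1 t, f2 t, f3 t] : Fin 3 → ℝ)) ![d1, d2, d3] u := by
  rw [hasDerivAt_pi]
  intro i
  fin_cases i
  · exact h1
  · exact h2
  · exact h3

lemma aux_formula (u x y p q r s N D : ℝ) (hu : u ≠ 0) (hD : D = u ^ 2 * (4 + x ^ 2 + y ^ 2)) :
    u * ((2 * (N * (x * q - y * p)) + (x + u * r) * (N * (y * -2 - 2 * q))
      + (y + u * s) * (N * (2 * p - x * -2))) / D)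
    = N * (r * (y * -2 - 2 * q) + s * (2 * p - x * -2)) / (4 + x ^ 2 + y ^ 2) := by
  have : 4 + x ^ 2 + y ^ 2 ≠ 0 := by positivity
  subst hD
  field_simp
  ring

/-- asymptotics of the limiting normal curvature along the `u`-axis. -/
theorem stmt_9     (a : ℝ) (b1 b3 c1 c3 : ℝ → ℝ) (b2 c2 : ℝ × ℝ → ℝ)
    (hb1 : ContDiff ℝ (⊤ : ℕ∞) b1) (hb3 : ContDiff ℝ (⊤ : ℕ∞) b3)
    (hc1s : ContDiff ℝ (⊤ : ℕ∞) c1) (hc3s : ContDiff ℝ (⊤ : ℕ∞) c3)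
    (hb2 : ContDiff ℝ (⊤ : ℕ∞) b2) (hc2 : ContDiff ℝ (⊤ : ℕ∞) c2)
    (ha : 0 < a) :
    Filter.Tendsto (fun u : ℝ => u * kapN a b1 b3 c1 c3 b2 c2 u) (𝓝[≠] (0 : ℝ))
      (𝓝 (3 * c1 0 / (4 * (1 + a ^ 2)))) := by
  set B : ℝ → ℝ := fun t => 3 * t * b1 t + t ^ 2 * deriv b1 t with hB
  set C : ℝ → ℝ := fun t => 3 * t * c1 t + t ^ 2 * deriv c1 t with hC
  set B' : ℝ → ℝ := fun u => 3 * b1 u + 5 * u * deriv b1 u + u ^ 2 * deriv (deriv b1) u with hB'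
  set C' : ℝ → ℝ := fun u => 3 * c1 u + 5 * u * deriv c1 u + u ^ 2 * deriv (deriv c1) u with hC'
  have cb := hb1.continuous
  have cc := hc1s.continuous
  have cb2 := hb2.continuous
  have cc2 := hc2.continuous
  have cdb := (aux_cd b1 hb1).continuous
  have cdc := (aux_cd c1 hc1s).continuous
  have cddb := (aux_cd _ (aux_cd b1 hb1)).continuous
  have cddc := (aux_cd _ (aux_cd c1 hc1s)).continuous
  have hNF : (fun t => NF a b1 b3 c1 c3 b2 c2 (t, 0))
      = fun t => ![t ^ 2, a * t ^ 2 + t ^ 3 * b1 t, t ^ 3 * c1 t] := by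
    funext t
    simp [NF, BC]
  have hsq : ∀ u : ℝ, HasDerivAt (fun t : ℝ => t ^ 2) (2 * u) u := fun u => by
    simpa using hasDerivAt_pow 2 u
  have hd1 : deriv (fun t => NF a b1 b3 c1 c3 b2 c2 (t, 0))
      = fun u => ![2 * u, a * (2 * u) + u * B u, u * C u] := by
    rw [hNF]
    funext u
    exact (aux_vec _ _ _ _ _ _ u (hsq u) (((hsq u).const_mul a).add (aux_d1_s9 b1 hb1 u))
      (aux_d1_s9 c1 hc1s u)).deriv
  have hl : ∀ u : ℝ, HasDerivAt (fun t : ℝ => 2 * t) 2 u := fun u => by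
    simpa using (hasDerivAt_id u).const_mul (2 : ℝ)
  have hd2 : ∀ u, deriv (deriv (fun t => NF a b1 b3 c1 c3 b2 c2 (t, 0))) u
      = ![2, (2 * a + B u) + u * B' u, C u + u * C' u] := by
    intro u
    rw [hd1]
    refine (aux_vec _ _ _ _ _ _ u (hl u) ((((hl u).const_mul a).add
      ((hasDerivAt_id u).mul (aux_d2_s9 b1 hb1 u))).congr_deriv ?_)
      (((hasDerivAt_id u).mul (aux_d2_s9 c1 hc1s u)).congr_deriv ?_)).deriv
    · simp [hB, hB']; ring
    · simp [hC, hC']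
  set p : ℝ → ℝ := fun u => 2 * a + 2 * u ^ 2 * b2 (u, 0) with hp
  set q : ℝ → ℝ := fun u => 2 * u ^ 2 * c2 (u, 0) with hq
  set K : ℝ → Fin 3 → ℝ := fun u => ![(2 * a + B u) * q u - C u * p u, C u * -2 - 2 * q u,
    2 * p u - (2 * a + B u) * -2] with hK
  have hnu : ∀ u, nuNF a b1 b3 c1 c3 b2 c2 (u, 0) = (norm3 (K u))⁻¹ • K u := by
    intro u
    have : cross3 (Phi1 a b1 c1 b2 c2 (u, 0)) (Phi2 a b3 c3 b2 c2 (u, 0)) = K u := by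
      simp [cross3, Phi1, Phi2, hK, hp, hq, hB, hC, add_assoc]
    rw [nuNF, this]
  set F : ℝ → ℝ := fun u => (norm3 (K u))⁻¹ * (B' u * (C u * -2 - 2 * q u)
    + C' u * (2 * p u - (2 * a + B u) * -2)) / (4 + (2 * a + B u) ^ 2 + C u ^ 2) with hF
  have key : ∀ u : ℝ, u ≠ 0 → u * kapN a b1 b3 c1 c3 b2 c2 u = F u := by
    intro u hu
    have hD : norm3 (deriv (fun t => NF a b1 b3 c1 c3 b2 c2 (t, 0)) u) ^ 2
        = u ^ 2 * (4 + (2 * a + B u) ^ 2 + C u ^ 2) := by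
      rw [hd1, norm3, Real.sq_sqrt]
      · simp [dot3]; ring
      · simp only [dot3]; nlinarith [mul_self_nonneg (2 * u), mul_self_nonneg (a * (2 * u) + u * B u), mul_self_nonneg (u * C u)]
    have := aux_formula u (2 * a + B u) (C u) (p u) (q u) (B' u) (C' u) (norm3 (K u))⁻¹ _ hu hD
    refine Eq.trans ?_ this
    rw [kapN, hd2, hnu]
    rfl
  have hK0 : norm3 (K 0) = 8 * a := by
    have : dot3 (K 0) (K 0) = (8 * a) ^ 2 := by
      simp [dot3, hK, hp, hq, hB, hC]; ring
    rw [norm3, this, Real.sqrt_sq (by positivity)]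
  have hF0 : F 0 = 3 * c1 0 / (4 * (1 + a ^ 2)) := by
    simp only [hF, hK0]
    simp [hp, hq, hB, hC, hB', hC']
    have : 4 + (2 * a) ^ 2 ≠ 0 := by positivity
    field_simp
    ring
  have hBc : Continuous B := by fun_prop
  have hCc : Continuous C := by fun_prop
  have hBc' : Continuous B' := by fun_prop
  have hCc' : Continuous C' := by fun_prop
  have hpc : Continuous p := by fun_prop
  have hqc : Continuous q := by fun_prop
  have hn : Continuous (fun u => norm3 (K u)) := by
    simp only [norm3, dot3, hK]
    simp
    fun_prop
  have hc : ContinuousAt F 0 := by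
    refine ContinuousAt.div (ContinuousAt.mul (hn.continuousAt.inv₀ ?_) ?_) ?_ ?_
    · rw [hK0]; positivity
    · exact Continuous.continuousAt (by fun_prop)
    · exact Continuous.continuousAt (by fun_prop)
    · positivity
  rw [← hF0]
  refine (hc.tendsto.mono_left nhdsWithin_le_nhds).congr' ?_
  filter_upwards [self_mem_nhdsWithin] with u hu
  exact (key u hu).symm
end
end

section
/- Fix the D₄⁺ normal form f with a > 0, with unit normal ν, and along the u-axis set κ_s(u) = sgn(u)·det(γ̂₁′(u), γ̂₁″(u), ν(u,0))/‖γ̂₁′(u)‖³ and κ_ν(u) = ⟨γ̂₁″(u), ν(u,0)⟩/‖γ̂₁′(u)‖² for u ≠ 0, where γ̂₁(u) = f(u,0). Then: (i) the singular curvature κ_s is bounded on some punctured interval {0 < |u| < ε} if and only if b₁(0) = 0; (ii) if c₁(0) ≠ 0, then the limiting normal curvature κ_ν is unbounded on every punctured interval {0 < |u| < ε}. -/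
open Real Filter Topology

noncomputable section

def pF (a : ℝ) (b : ℝ → ℝ) (u : ℝ) : ℝ := 2 * a + 3 * u * b u + u ^ 2 * deriv b u

lemma contDiff_deriv_of_top {b : ℝ → ℝ} (hb : ContDiff ℝ (⊤ : ℕ∞) b) :
    ContDiff ℝ (⊤ : ℕ∞) (deriv b) := (contDiff_infty_iff_deriv.mp hb).2

lemma pF_contDiff (a : ℝ) {b : ℝ → ℝ} (hb : ContDiff ℝ (⊤ : ℕ∞) b) :
    ContDiff ℝ (⊤ : ℕ∞) (pF a b) := by
  have := contDiff_deriv_of_top hb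
  unfold pF
  fun_prop

lemma pF_deriv_zero (a : ℝ) {b : ℝ → ℝ} (hb : ContDiff ℝ (⊤ : ℕ∞) b) :
    deriv (pF a b) 0 = 3 * b 0 := by
  have h1 : HasDerivAt b (deriv b 0) 0 := (hb.differentiable (by simp) 0).hasDerivAt
  have h2 : HasDerivAt (deriv b) (deriv (deriv b) 0) 0 :=
    ((contDiff_deriv_of_top hb).differentiable (by simp) 0).hasDerivAt
  have h := ((((hasDerivAt_id (0:ℝ)).const_mul 3).mul h1).const_add (2 * a)).add
    (((hasDerivAt_id (0:ℝ)).pow 2).mul h2)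
  have h' : HasDerivAt (pF a b) (3 * b 0) 0 := by
    refine (h.congr_deriv (by simp)).congr_of_eventuallyEq (Eventually.of_forall fun x => ?_)
    simp [pF]
  exact h'.deriv

lemma cubic_deriv (a : ℝ) {b : ℝ → ℝ} (hb : ContDiff ℝ (⊤ : ℕ∞) b) (u : ℝ) :
    HasDerivAt (fun t => a * t ^ 2 + t ^ 3 * b t) (u * pF a b u) u := by
  have h1 : HasDerivAt b (deriv b u) u := (hb.differentiable (by simp) u).hasDerivAt
  have h := (((hasDerivAt_id u).pow 2).const_mul a).add (((hasDerivAt_id u).pow 3).mul h1)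
  refine (h.congr_deriv (by simp [pF]; ring)).congr_of_eventuallyEq
    (Eventually.of_forall fun x => ?_)
  simp

section
variable (a : ℝ) (b1 b3 c1 c3 : ℝ → ℝ) (b2 c2 : ℝ × ℝ → ℝ)

lemma NF_deriv (hb1 : ContDiff ℝ (⊤ : ℕ∞) b1) (hc1 : ContDiff ℝ (⊤ : ℕ∞) c1) :
    deriv (fun t => NF a b1 b3 c1 c3 b2 c2 (t, 0)) =
      fun u => ![2 * u, u * pF a b1 u, u * pF 0 c1 u] := by
  funext u
  apply HasDerivAt.deriv
  rw [hasDerivAt_pi]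
  intro i
  fin_cases i
  · simpa [NF] using hasDerivAt_pow 2 u
  · simpa [NF, BC] using cubic_deriv a hb1 u
  · simpa [NF, BC] using cubic_deriv 0 hc1 u

lemma NF_deriv2 (hb1 : ContDiff ℝ (⊤ : ℕ∞) b1) (hc1 : ContDiff ℝ (⊤ : ℕ∞) c1) :
    deriv (deriv (fun t => NF a b1 b3 c1 c3 b2 c2 (t, 0))) =
      fun u => ![2, pF a b1 u + u * deriv (pF a b1) u,
        pF 0 c1 u + u * deriv (pF 0 c1) u] := by
  rw [NF_deriv a b1 b3 c1 c3 b2 c2 hb1 hc1]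
  funext u
  apply HasDerivAt.deriv
  rw [hasDerivAt_pi]
  have hh : ∀ g : ℝ → ℝ, ContDiff ℝ (⊤ : ℕ∞) g →
      HasDerivAt (fun t => t * g t) (g u + u * deriv g u) u := by
    intro g hg
    have h1 : HasDerivAt g (deriv g u) u := (hg.differentiable (by simp) u).hasDerivAt
    exact ((hasDerivAt_id u).mul h1).congr_deriv (by simp)
  intro i
  fin_cases i
  · simpa using (hasDerivAt_id u).const_mul 2
  · simpa using hh _ (pF_contDiff a hb1)
  · simpa using hh _ (pF_contDiff 0 hc1)

/-- cross product along the axis -/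
def CC (u : ℝ) : Fin 3 → ℝ :=
  ![pF a b1 u * (2 * u ^ 2 * c2 (u, 0)) - pF 0 c1 u * (2 * a + 2 * u ^ 2 * b2 (u, 0)),
    pF 0 c1 u * (-2) - 2 * (2 * u ^ 2 * c2 (u, 0)),
    2 * (2 * a + 2 * u ^ 2 * b2 (u, 0)) - pF a b1 u * (-2)]

lemma cross_eq (u : ℝ) :
    cross3 (Phi1 a b1 c1 b2 c2 (u, 0)) (Phi2 a b3 c3 b2 c2 (u, 0)) = CC a b1 c1 b2 c2 u := by
  simp [cross3, Phi1, Phi2, CC, pF]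

def nC (u : ℝ) : ℝ := norm3 (CC a b1 c1 b2 c2 u)
def nP (u : ℝ) : ℝ := Real.sqrt (4 + pF a b1 u ^ 2 + pF 0 c1 u ^ 2)

def HS (u : ℝ) : ℝ :=
  2 * (deriv (pF a b1) u * CC a b1 c1 b2 c2 u 2 - deriv (pF 0 c1) u * CC a b1 c1 b2 c2 u 1)
  + (pF a b1 u * deriv (pF 0 c1) u - pF 0 c1 u * deriv (pF a b1) u) * CC a b1 c1 b2 c2 u 0

def HN (u : ℝ) : ℝ :=
  deriv (pF a b1) u * CC a b1 c1 b2 c2 u 1 + deriv (pF 0 c1) u * CC a b1 c1 b2 c2 u 2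

lemma norm_eq (u : ℝ) :
    norm3 ![2 * u, u * pF a b1 u, u * pF 0 c1 u] = |u| * nP a b1 c1 u := by
  have : dot3 ![2 * u, u * pF a b1 u, u * pF 0 c1 u] ![2 * u, u * pF a b1 u, u * pF 0 c1 u]
      = u ^ 2 * (4 + pF a b1 u ^ 2 + pF 0 c1 u ^ 2) := by
    simp [dot3]; ring
  rw [norm3, this, Real.sqrt_mul (sq_nonneg u), Real.sqrt_sq_eq_abs, nP]

lemma nP_pos (u : ℝ) : 0 < nP a b1 c1 u := Real.sqrt_pos.2 (by positivity)

lemma nC_nonneg (u : ℝ) : 0 ≤ nC a b1 c1 b2 c2 u := Real.sqrt_nonneg _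

lemma kapS_eq (hb1 : ContDiff ℝ (⊤ : ℕ∞) b1) (hc1 : ContDiff ℝ (⊤ : ℕ∞) c1) (u : ℝ)
    (hu : u ≠ 0) :
    kapS a b1 b3 c1 c3 b2 c2 u =
      HS a b1 c1 b2 c2 u / u * (nC a b1 c1 b2 c2 u * nP a b1 c1 u ^ 3)⁻¹ := by
  unfold kapS nuNF
  rw [NF_deriv2 a b1 b3 c1 c3 b2 c2 hb1 hc1, NF_deriv a b1 b3 c1 c3 b2 c2 hb1 hc1, cross_eq]
  simp only []
  rw [norm_eq]
  have hd : det3 ![2 * u, u * pF a b1 u, u * pF 0 c1 u]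
      ![2, pF a b1 u + u * deriv (pF a b1) u, pF 0 c1 u + u * deriv (pF 0 c1) u]
      ((norm3 (CC a b1 c1 b2 c2 u))⁻¹ • CC a b1 c1 b2 c2 u)
      = u ^ 2 * ((nC a b1 c1 b2 c2 u)⁻¹ * HS a b1 c1 b2 c2 u) := by
    simp [det3, Matrix.det_fin_three, HS, nC]; ring
  rw [hd]
  have hp := (nP_pos a b1 c1 u).ne'
  have hs : Real.sign u * u ^ 2 / |u| ^ 3 = 1 / u := by
    rcases lt_or_gt_of_ne hu with h | h
    · rw [Real.sign_of_neg h, abs_of_neg h]; field_simp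
    · rw [Real.sign_of_pos h, abs_of_pos h]; field_simp
  calc _ = (Real.sign u * u ^ 2 / |u| ^ 3) *
        (HS a b1 c1 b2 c2 u * (nC a b1 c1 b2 c2 u * nP a b1 c1 u ^ 3)⁻¹) := by
        rw [mul_inv, mul_pow, div_eq_mul_inv, div_eq_mul_inv, mul_inv]; ring
    _ = _ := by rw [hs]; ring

lemma kapN_eq (hb1 : ContDiff ℝ (⊤ : ℕ∞) b1) (hc1 : ContDiff ℝ (⊤ : ℕ∞) c1) (u : ℝ)
    (hu : u ≠ 0) :
    kapN a b1 b3 c1 c3 b2 c2 u =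
      HN a b1 c1 b2 c2 u / u * (nC a b1 c1 b2 c2 u * nP a b1 c1 u ^ 2)⁻¹ := by
  unfold kapN nuNF
  rw [NF_deriv2 a b1 b3 c1 c3 b2 c2 hb1 hc1, NF_deriv a b1 b3 c1 c3 b2 c2 hb1 hc1, cross_eq]
  simp only []
  rw [norm_eq]
  have hd : dot3 
      ![2, pF a b1 u + u * deriv (pF a b1) u, pF 0 c1 u + u * deriv (pF 0 c1) u]
      ((norm3 (CC a b1 c1 b2 c2 u))⁻¹ • CC a b1 c1 b2 c2 u)
      = u * ((nC a b1 c1 b2 c2 u)⁻¹ * HN a b1 c1 b2 c2 u) := by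
    simp [dot3, HN, nC, CC]; ring
  rw [hd, mul_pow, sq_abs, mul_inv]
  have hp := (nP_pos a b1 c1 u).ne'
  field_simp

lemma CC_diff (hb1 : ContDiff ℝ (⊤ : ℕ∞) b1) (hc1 : ContDiff ℝ (⊤ : ℕ∞) c1)
    (hb2 : ContDiff ℝ (⊤ : ℕ∞) b2) (hc2 : ContDiff ℝ (⊤ : ℕ∞) c2) (i : Fin 3) :
    ContDiff ℝ (⊤ : ℕ∞) (fun u => CC a b1 c1 b2 c2 u i) := by
  have h1 := pF_contDiff a hb1
  have h2 := pF_contDiff 0 hc1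
  have h3 : ContDiff ℝ (⊤ : ℕ∞) (fun u : ℝ => b2 (u, 0)) := hb2.comp (by fun_prop)
  have h4 : ContDiff ℝ (⊤ : ℕ∞) (fun u : ℝ => c2 (u, 0)) := hc2.comp (by fun_prop)
  fin_cases i <;> simp [CC] <;> fun_prop

lemma HS_diff (hb1 : ContDiff ℝ (⊤ : ℕ∞) b1) (hc1 : ContDiff ℝ (⊤ : ℕ∞) c1)
    (hb2 : ContDiff ℝ (⊤ : ℕ∞) b2) (hc2 : ContDiff ℝ (⊤ : ℕ∞) c2) :
    ContDiff ℝ (⊤ : ℕ∞) (HS a b1 c1 b2 c2) := by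
  have h1 := pF_contDiff a hb1
  have h2 := pF_contDiff 0 hc1
  have h3 := contDiff_deriv_of_top h1
  have h4 := contDiff_deriv_of_top h2
  have h5 := CC_diff a b1 c1 b2 c2 hb1 hc1 hb2 hc2
  have h50 := h5 0
  have h51 := h5 1
  have h52 := h5 2
  unfold HS
  fun_prop

lemma HN_diff (hb1 : ContDiff ℝ (⊤ : ℕ∞) b1) (hc1 : ContDiff ℝ (⊤ : ℕ∞) c1)
    (hb2 : ContDiff ℝ (⊤ : ℕ∞) b2) (hc2 : ContDiff ℝ (⊤ : ℕ∞) c2) :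
    ContDiff ℝ (⊤ : ℕ∞) (HN a b1 c1 b2 c2) := by
  have h1 := pF_contDiff a hb1
  have h2 := pF_contDiff 0 hc1
  have h3 := contDiff_deriv_of_top h1
  have h4 := contDiff_deriv_of_top h2
  have h5 := CC_diff a b1 c1 b2 c2 hb1 hc1 hb2 hc2
  have h51 := h5 1
  have h52 := h5 2
  unfold HN
  fun_prop

lemma nC_cont (hb1 : ContDiff ℝ (⊤ : ℕ∞) b1) (hc1 : ContDiff ℝ (⊤ : ℕ∞) c1)
    (hb2 : ContDiff ℝ (⊤ : ℕ∞) b2) (hc2 : ContDiff ℝ (⊤ : ℕ∞) c2) :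
    Continuous (nC a b1 c1 b2 c2) := by
  have h5 := CC_diff a b1 c1 b2 c2 hb1 hc1 hb2 hc2
  have h50 := (h5 0).continuous
  have h51 := (h5 1).continuous
  have h52 := (h5 2).continuous
  unfold nC norm3 dot3
  fun_prop

lemma nP_cont (hb1 : ContDiff ℝ (⊤ : ℕ∞) b1) (hc1 : ContDiff ℝ (⊤ : ℕ∞) c1) :
    Continuous (nP a b1 c1) := by
  have h1 := (pF_contDiff a hb1).continuous
  have h2 := (pF_contDiff 0 hc1).continuous
  unfold nP
  fun_prop

lemma nC_zero (ha : 0 < a) : 0 < nC a b1 c1 b2 c2 0 := by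
  apply Real.sqrt_pos.2
  simp [dot3, CC, pF]
  positivity

lemma HS_zero (hb1 : ContDiff ℝ (⊤ : ℕ∞) b1) (hc1 : ContDiff ℝ (⊤ : ℕ∞) c1) :
    HS a b1 c1 b2 c2 0 = 48 * a * b1 0 := by
  rw [HS, pF_deriv_zero a hb1, pF_deriv_zero 0 hc1]
  simp [CC, pF]
  ring

lemma HN_zero (hb1 : ContDiff ℝ (⊤ : ℕ∞) b1) (hc1 : ContDiff ℝ (⊤ : ℕ∞) c1) :
    HN a b1 c1 b2 c2 0 = 24 * a * c1 0 := by
  rw [HN, pF_deriv_zero a hb1, pF_deriv_zero 0 hc1]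
  simp [CC, pF]
  ring
end

lemma unbdd_aux (H K : ℝ → ℝ) (hH : ContinuousAt H 0) (hK : ContinuousAt K 0)
    (hK0 : 0 < K 0) (h0 : H 0 ≠ 0) (ε : ℝ) (hε : 0 < ε) (M : ℝ) :
    ∃ u : ℝ, u ≠ 0 ∧ |u| < ε ∧ M < |H u / u * (K u)⁻¹| := by
  have h1 : Tendsto (fun u => |H u * (K u)⁻¹|) (𝓝[≠] 0) (𝓝 |H 0 * (K 0)⁻¹|) :=
    ((hH.mul (hK.inv₀ hK0.ne')).abs).tendsto.mono_left nhdsWithin_le_nhds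
  have h2 : Tendsto (fun u : ℝ => |u|⁻¹) (𝓝[≠] 0) atTop := by
    have := tendsto_norm_inv_nhdsNE_zero_atTop (α := ℝ)
    simpa [Real.norm_eq_abs, abs_inv] using this
  have h3 := h1.pos_mul_atTop (abs_pos.2 (mul_ne_zero h0 (inv_ne_zero hK0.ne'))) h2
  have h4 : ∀ᶠ u : ℝ in 𝓝[≠] 0, |u| < ε := by
    apply nhdsWithin_le_nhds
    have : ContinuousAt (fun u : ℝ => |u|) 0 := by fun_prop
    exact this.eventually_lt continuousAt_const (by simpa using hε)
  obtain ⟨u, hu1, hu2, hu3⟩ :=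
    ((h3.eventually_gt_atTop M).and (h4.and self_mem_nhdsWithin)).exists
  refine ⟨u, hu3, hu2, ?_⟩
  rw [← abs_inv, ← abs_mul] at hu1
  have e : H u / u * (K u)⁻¹ = H u * (K u)⁻¹ * u⁻¹ := by ring
  rw [e]
  exact hu1

lemma bdd_aux (H K : ℝ → ℝ) (hH : DifferentiableAt ℝ H 0) (hK : ContinuousAt K 0)
    (hK0 : 0 < K 0) (h0 : H 0 = 0) :
    ∃ ε > (0 : ℝ), ∃ M : ℝ, ∀ u : ℝ, u ≠ 0 → |u| < ε → |H u / u * (K u)⁻¹| ≤ M := by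
  have h1 : Tendsto (fun u => H u / u) (𝓝[≠] 0) (𝓝 (deriv H 0)) := by
    have := hasDerivAt_iff_tendsto_slope.1 hH.hasDerivAt
    refine this.congr fun u => ?_
    simp [slope_def_field, h0]
  have h2 : Tendsto (fun u => (K u)⁻¹) (𝓝[≠] 0) (𝓝 (K 0)⁻¹) :=
    (hK.inv₀ hK0.ne').tendsto.mono_left nhdsWithin_le_nhds
  have h3 := (h1.mul h2).abs.eventually_lt_const (lt_add_one _)
  rw [eventually_nhdsWithin_iff, Metric.eventually_nhds_iff] at h3
  obtain ⟨ε, hε, h⟩ := h3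
  exact ⟨ε, hε, _, fun u hu hue => (h (by simpa using hue) hu).le⟩

/-- boundedness of the singular curvature and unboundedness of the
limiting normal curvature. -/
theorem stmt_10     (a : ℝ) (b1 b3 c1 c3 : ℝ → ℝ) (b2 c2 : ℝ × ℝ → ℝ)
    (hb1 : ContDiff ℝ (⊤ : ℕ∞) b1) (hb3 : ContDiff ℝ (⊤ : ℕ∞) b3)
    (hc1s : ContDiff ℝ (⊤ : ℕ∞) c1) (hc3s : ContDiff ℝ (⊤ : ℕ∞) c3)
    (hb2 : ContDiff ℝ (⊤ : ℕ∞) b2) (hc2 : ContDiff ℝ (⊤ : ℕ∞) c2)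
    (ha : 0 < a) :
    ((∃ ε > (0 : ℝ), ∃ M : ℝ, ∀ u : ℝ, u ≠ 0 → |u| < ε →
        |kapS a b1 b3 c1 c3 b2 c2 u| ≤ M) ↔ b1 0 = 0) ∧
    (c1 0 ≠ 0 → ∀ ε > (0 : ℝ), ∀ M : ℝ, ∃ u : ℝ,
      u ≠ 0 ∧ |u| < ε ∧ M < |kapN a b1 b3 c1 c3 b2 c2 u|) := by
  have hnC := (nC_cont a b1 c1 b2 c2 hb1 hc1s hb2 hc2)
  have hnP := (nP_cont a b1 c1 hb1 hc1s)
  have p1 := nC_zero a b1 c1 b2 c2 ha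
  have p2 := nP_pos a b1 c1 0
  have hHS := HS_diff a b1 c1 b2 c2 hb1 hc1s hb2 hc2
  have hHN := HN_diff a b1 c1 b2 c2 hb1 hc1s hb2 hc2
  have k3 := (hnC.mul (hnP.pow 3)).continuousAt (x := 0)
  have k2 := (hnC.mul (hnP.pow 2)).continuousAt (x := 0)
  refine ⟨⟨?_, ?_⟩, ?_⟩
  · rintro ⟨ε, hε, M, h⟩
    by_contra hne
    obtain ⟨u, hu, hue, hM⟩ := unbdd_aux _ _ hHS.continuous.continuousAt k3
      (mul_pos p1 (pow_pos p2 3))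
      (by rw [HS_zero a b1 c1 b2 c2 hb1 hc1s]; exact mul_ne_zero (by positivity) hne) ε hε M
    have := h u hu hue
    rw [kapS_eq a b1 b3 c1 c3 b2 c2 hb1 hc1s u hu] at this
    exact absurd hM (not_lt.2 this)
  · intro h0
    obtain ⟨ε, hε, M, h⟩ := bdd_aux _ _ (hHS.differentiable (by simp) 0) k3
      (mul_pos p1 (pow_pos p2 3)) (by rw [HS_zero a b1 c1 b2 c2 hb1 hc1s, h0, mul_zero])
    refine ⟨ε, hε, M, fun u hu hue => ?_⟩
    rw [kapS_eq a b1 b3 c1 c3 b2 c2 hb1 hc1s u hu]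
    exact h u hu hue
  · intro hne ε hε M
    obtain ⟨u, hu, hue, hM⟩ := unbdd_aux _ _ hHN.continuous.continuousAt k2
      (mul_pos p1 (pow_pos p2 2))
      (by rw [HN_zero a b1 c1 b2 c2 hb1 hc1s]; exact mul_ne_zero (by positivity) hne) ε hε M
    refine ⟨u, hu, hue, ?_⟩
    rw [kapN_eq a b1 b3 c1 c3 b2 c2 hb1 hc1s u hu]
    exact hM
end
end

section
/- Fix the D₄⁺ normal form f with a > 0 and let γ̂₁(u) = f(u,0) = (u², a u² + u³ b₁(u), u³ c₁(u)). Let γ̂₁ⁿ(u) = (u², a u² + u³ b₁(u)) be its orthogonal projection to the xy-plane (the plane orthogonal to the unit normal ν(0,0) = (0,0,1)) and γ̂₁ᶜ(u) = (u², u³ c₁(u)) its orthogonal projection to the xz-plane (the plane orthogonal to the center line, which is the y-axis). Then both projected curves have vanishing first derivative and nonvanishing second derivative at u = 0, and their cuspidal curvatures are Ω(γ̂₁ⁿ) = 3 b₁(0)/(√2 (1+a²)^{5/4}) and Ω(γ̂₁ᶜ) = 3 c₁(0)/√2. -/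
open Real Filter Topology

noncomputable section

/-- `2 × 2` determinant of two vectors in `ℝ²`. -/
def det2 (x y : ℝ × ℝ) : ℝ := x.1 * y.2 - x.2 * y.1

/-- Euclidean norm on `ℝ²`. -/
def norm2 (x : ℝ × ℝ) : ℝ := Real.sqrt (x.1 ^ 2 + x.2 ^ 2)

lemma aux_derivs (a : ℝ) (g : ℝ → ℝ) (hg : ContDiff ℝ (⊤ : ℕ∞) g) :
    deriv (fun u : ℝ => ((u ^ 2, a * u ^ 2 + u ^ 3 * g u) : ℝ × ℝ)) 0 = 0 ∧
    deriv (deriv (fun u : ℝ => ((u ^ 2, a * u ^ 2 + u ^ 3 * g u) : ℝ × ℝ))) 0 = (2, 2 * a) ∧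
    deriv (deriv (deriv (fun u : ℝ => ((u ^ 2, a * u ^ 2 + u ^ 3 * g u) : ℝ × ℝ)))) 0
      = (0, 6 * g 0) := by
  have hg1 : ContDiff ℝ (⊤ : ℕ∞) (deriv g) := (contDiff_infty_iff_deriv.1 hg).2
  have hg2 : ContDiff ℝ (⊤ : ℕ∞) (deriv (deriv g)) := (contDiff_infty_iff_deriv.1 hg1).2
  have d0 : ∀ u, HasDerivAt g (deriv g u) u := fun u =>
    ((contDiff_infty_iff_deriv.1 hg).1 u).hasDerivAt
  have d1 : ∀ u, HasDerivAt (deriv g) (deriv (deriv g) u) u := fun u =>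
    ((contDiff_infty_iff_deriv.1 hg1).1 u).hasDerivAt
  have d2 : ∀ u, HasDerivAt (deriv (deriv g)) (deriv (deriv (deriv g)) u) u := fun u =>
    ((contDiff_infty_iff_deriv.1 hg2).1 u).hasDerivAt
  have p1 : ∀ u : ℝ, HasDerivAt (fun u : ℝ => u) 1 u := fun u => hasDerivAt_id' u
  have p2 : ∀ u : ℝ, HasDerivAt (fun u : ℝ => u ^ 2) (2 * u) u := fun u => by
    simpa using hasDerivAt_pow 2 u
  have p3 : ∀ u : ℝ, HasDerivAt (fun u : ℝ => u ^ 3) (3 * u ^ 2) u := fun u => by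
    simpa using hasDerivAt_pow 3 u
  have e1 : deriv (fun u : ℝ => ((u ^ 2, a * u ^ 2 + u ^ 3 * g u) : ℝ × ℝ)) =
      fun u => (2 * u, a * (2 * u) + (3 * u ^ 2 * g u + u ^ 3 * deriv g u)) := by
    funext u
    exact ((p2 u).prodMk (((p2 u).const_mul a).add ((p3 u).mul (d0 u)))).deriv
  have e2 : deriv (fun u : ℝ =>
        ((2 * u, a * (2 * u) + (3 * u ^ 2 * g u + u ^ 3 * deriv g u)) : ℝ × ℝ)) =
      fun u => (2 * 1, a * (2 * 1) + ((3 * (2 * u) * g u + 3 * u ^ 2 * deriv g u) +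
        (3 * u ^ 2 * deriv g u + u ^ 3 * deriv (deriv g) u))) := by
    funext u
    exact (((p1 u).const_mul 2).prodMk ((((p1 u).const_mul 2).const_mul a).add
      ((((p2 u).const_mul 3).mul (d0 u)).add ((p3 u).mul (d1 u))))).deriv
  have e3 : deriv (fun u : ℝ =>
        ((2 * 1, a * (2 * 1) + ((3 * (2 * u) * g u + 3 * u ^ 2 * deriv g u) +
        (3 * u ^ 2 * deriv g u + u ^ 3 * deriv (deriv g) u))) : ℝ × ℝ)) 0 = (0, 6 * g 0) := by
    have h := ((hasDerivAt_const (0:ℝ) (2 * 1 : ℝ)).prodMk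
      ((hasDerivAt_const (0:ℝ) (a * (2 * 1))).add
      ((((((p1 0).const_mul 2).const_mul 3).mul (d0 0)).add
        (((p2 0).const_mul 3).mul (d1 0))).add
        ((((p2 0).const_mul 3).mul (d1 0)).add ((p3 0).mul (d2 0)))))).deriv
    refine Eq.trans h ?_
    ext <;> simp
    left; norm_num
  refine ⟨?_, ?_, ?_⟩
  · rw [e1]; simp
  · rw [e1, e2]; ext <;> simp; ring
  · rw [e1, e2, e3]

lemma aux_curv (a t : ℝ) :
    det2 (2, 2 * a) (0, 6 * t) / norm2 (2, 2 * a) ^ ((5 : ℝ) / 2) =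
      3 * t / (Real.sqrt 2 * (1 + a ^ 2) ^ ((5 : ℝ) / 4)) := by
  have hp : (0:ℝ) < 1 + a ^ 2 := by positivity
  have h4 : ((4:ℝ)) ^ ((5 : ℝ) / 4) = 4 * Real.sqrt 2 := by
    rw [show (4:ℝ) = 2 ^ (2:ℝ) by norm_num, ← Real.rpow_mul (by norm_num),
      Real.sqrt_eq_rpow, ← Real.rpow_add (by norm_num)]
    norm_num
  have hn : norm2 (2, 2 * a) ^ ((5 : ℝ) / 2) =
      4 * Real.sqrt 2 * (1 + a ^ 2) ^ ((5 : ℝ) / 4) := by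
    rw [norm2, Real.sqrt_eq_rpow, ← Real.rpow_mul (by positivity), ← h4,
      ← Real.mul_rpow (by norm_num) hp.le]
    congr 1
    · ring
    · norm_num
  rw [hn, det2]
  have : (0:ℝ) < (1 + a ^ 2) ^ ((5 : ℝ) / 4) := Real.rpow_pos_of_pos hp _
  have : (0:ℝ) < Real.sqrt 2 := by positivity
  field_simp
  ring

/-- cuspidal curvatures of the projections of the singular curve
`γ̂₁(u) = f(u,0)` to the tangent plane and to the plane normal to the center line. -/
theorem stmt_12     (a : ℝ) (b1 b3 c1 c3 : ℝ → ℝ) (b2 c2 : ℝ × ℝ → ℝ)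
    (hb1 : ContDiff ℝ (⊤ : ℕ∞) b1) (hb3 : ContDiff ℝ (⊤ : ℕ∞) b3)
    (hc1s : ContDiff ℝ (⊤ : ℕ∞) c1) (hc3s : ContDiff ℝ (⊤ : ℕ∞) c3)
    (hb2 : ContDiff ℝ (⊤ : ℕ∞) b2) (hc2 : ContDiff ℝ (⊤ : ℕ∞) c2)
    (ha : 0 < a) :
    deriv (fun u : ℝ => ((u ^ 2, a * u ^ 2 + u ^ 3 * b1 u) : ℝ × ℝ)) 0 = 0 ∧
    deriv (deriv (fun u : ℝ => ((u ^ 2, a * u ^ 2 + u ^ 3 * b1 u) : ℝ × ℝ))) 0 ≠ 0 ∧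
    deriv (fun u : ℝ => ((u ^ 2, u ^ 3 * c1 u) : ℝ × ℝ)) 0 = 0 ∧
    deriv (deriv (fun u : ℝ => ((u ^ 2, u ^ 3 * c1 u) : ℝ × ℝ))) 0 ≠ 0 ∧
    det2 (deriv (deriv (fun u : ℝ => ((u ^ 2, a * u ^ 2 + u ^ 3 * b1 u) : ℝ × ℝ))) 0)
        (deriv (deriv (deriv (fun u : ℝ => ((u ^ 2, a * u ^ 2 + u ^ 3 * b1 u) : ℝ × ℝ)))) 0) /
      norm2 (deriv (deriv (fun u : ℝ => ((u ^ 2, a * u ^ 2 + u ^ 3 * b1 u) : ℝ × ℝ))) 0) ^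
        ((5 : ℝ) / 2) =
      3 * b1 0 / (Real.sqrt 2 * (1 + a ^ 2) ^ ((5 : ℝ) / 4)) ∧
    det2 (deriv (deriv (fun u : ℝ => ((u ^ 2, u ^ 3 * c1 u) : ℝ × ℝ))) 0)
        (deriv (deriv (deriv (fun u : ℝ => ((u ^ 2, u ^ 3 * c1 u) : ℝ × ℝ)))) 0) /
      norm2 (deriv (deriv (fun u : ℝ => ((u ^ 2, u ^ 3 * c1 u) : ℝ × ℝ))) 0) ^
        ((5 : ℝ) / 2) =
      3 * c1 0 / Real.sqrt 2 := by
  obtain ⟨h1, h2, h3⟩ := aux_derivs a b1 hb1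
  have k := aux_derivs 0 c1 hc1s
  simp only [zero_mul, zero_add] at k
  obtain ⟨k1, k2, k3⟩ := k
  refine ⟨h1, ?_, k1, ?_, ?_, ?_⟩
  · rw [h2]; simp
  · rw [k2]; simp
  · rw [h2, h3]; exact aux_curv a (b1 0)
  · rw [k2, k3]; simpa using aux_curv 0 (c1 0)
end
end

section
/- Fix the D₄⁺ normal form f with a > 0, c₁(0) > 0, c₃(0) > 0. Suppose T ∈ O(3) and σ is a C^∞ diffeomorphism between neighborhoods of the origin in ℝ² with σ(0,0) = (0,0), such that T·f(σ(u,v)) = f(u,v) for all (u,v) in a neighborhood of the origin. Then T is one of the four diagonal matrices diag(1,1,1), diag(1,1,−1), diag(−1,1,1), diag(−1,1,−1); i.e., if T is not the identity, then T is the reflection in the tangent plane {z = 0}, the reflection in the principal plane {x = 0}, or the π-rotation about the center line (the y-axis). -/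
open Real Filter Topology

noncomputable section

theorem BC_lim (b1 b3 : ℝ → ℝ) (b2 : ℝ × ℝ → ℝ) (h1 : Continuous b1) (h3 : Continuous b3)
    (h2 : Continuous b2) (g : ℝ → ℝ × ℝ) (hg0 : Tendsto g (𝓝[≠] 0) (𝓝 0)) (w : ℝ × ℝ)
    (hx : Tendsto (fun t => (g t).1 / t) (𝓝[≠] 0) (𝓝 w.1))
    (hy : Tendsto (fun t => (g t).2 / t) (𝓝[≠] 0) (𝓝 w.2)) :
    Tendsto (fun t => BC b1 b3 b2 (g t) / t ^ 2) (𝓝[≠] 0) (𝓝 0) := by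
  have e1 : Tendsto (fun t => (g t).1) (𝓝[≠] 0) (𝓝 0) := (continuous_fst.tendsto (0 : ℝ × ℝ)).comp hg0
  have e2 : Tendsto (fun t => (g t).2) (𝓝[≠] 0) (𝓝 0) := (continuous_snd.tendsto (0 : ℝ × ℝ)).comp hg0
  have f1 : Tendsto (fun t => b1 (g t).1) (𝓝[≠] 0) (𝓝 (b1 0)) := (h1.tendsto 0).comp e1
  have f3 : Tendsto (fun t => b3 (g t).2) (𝓝[≠] 0) (𝓝 (b3 0)) := (h3.tendsto 0).comp e2
  have f2 : Tendsto (fun t => b2 (g t)) (𝓝[≠] 0) (𝓝 (b2 0)) := (h2.tendsto 0).comp hg0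
  have := ((((hx.pow 2).mul e1).mul f1).add (((hx.pow 2).mul (e2.pow 2)).mul f2)).add
    (((hy.pow 2).mul e2).mul f3)
  simp only [mul_zero, zero_mul, add_zero, ne_eq, OfNat.ofNat_ne_zero, not_false_eq_true, zero_pow] at this
  refine this.congr fun t => ?_
  simp only [BC]
  ring

theorem NF_lim (a : ℝ) (b1 b3 c1 c3 : ℝ → ℝ) (b2 c2 : ℝ × ℝ → ℝ)
    (hb1 : Continuous b1) (hb3 : Continuous b3) (hc1 : Continuous c1) (hc3 : Continuous c3)
    (hb2 : Continuous b2) (hc2 : Continuous c2) (g : ℝ → ℝ × ℝ) (w : ℝ × ℝ) (hg : g 0 = 0)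
    (hd : HasDerivAt g w 0) :
    Tendsto (fun t => NF a b1 b3 c1 c3 b2 c2 (g t) 0 / t ^ 2) (𝓝[≠] 0) (𝓝 (w.1 ^ 2 - w.2 ^ 2)) ∧
    Tendsto (fun t => NF a b1 b3 c1 c3 b2 c2 (g t) 1 / t ^ 2) (𝓝[≠] 0)
      (𝓝 (a * (w.1 ^ 2 + w.2 ^ 2))) ∧
    Tendsto (fun t => NF a b1 b3 c1 c3 b2 c2 (g t) 2 / t ^ 2) (𝓝[≠] 0) (𝓝 0) := by
  have hg0 : Tendsto g (𝓝[≠] 0) (𝓝 0) := by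
    have := hd.continuousAt.tendsto
    rw [hg] at this
    exact this.mono_left nhdsWithin_le_nhds
  have hs := hasDerivAt_iff_tendsto_slope.1 hd
  have hx : Tendsto (fun t => (g t).1 / t) (𝓝[≠] 0) (𝓝 w.1) := by
    refine ((continuous_fst.tendsto w).comp hs).congr fun t => ?_
    simp [slope, hg, div_eq_inv_mul]
  have hy : Tendsto (fun t => (g t).2 / t) (𝓝[≠] 0) (𝓝 w.2) := by
    refine ((continuous_snd.tendsto w).comp hs).congr fun t => ?_
    simp [slope, hg, div_eq_inv_mul]
  refine ⟨?_, ?_, ?_⟩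
  · refine ((hx.pow 2).sub (hy.pow 2)).congr fun t => ?_
    simp only [NF, Matrix.cons_val]
    ring
  · have := (((hx.pow 2).add (hy.pow 2)).const_mul a).add
      (BC_lim b1 b3 b2 hb1 hb3 hb2 g hg0 w hx hy)
    rw [add_zero] at this
    refine this.congr fun t => ?_
    simp only [NF, Matrix.cons_val]
    ring
  · refine (BC_lim c1 c3 c2 hc1 hc3 hc2 g hg0 w hx hy).congr fun t => ?_
    simp only [NF, Matrix.cons_val]

/-- the possible extrinsic symmetries of a `D₄⁺`-singularity. -/
theorem stmt_13     (a : ℝ) (b1 b3 c1 c3 : ℝ → ℝ) (b2 c2 : ℝ × ℝ → ℝ)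
    (hb1 : ContDiff ℝ (⊤ : ℕ∞) b1) (hb3 : ContDiff ℝ (⊤ : ℕ∞) b3)
    (hc1s : ContDiff ℝ (⊤ : ℕ∞) c1) (hc3s : ContDiff ℝ (⊤ : ℕ∞) c3)
    (hb2 : ContDiff ℝ (⊤ : ℕ∞) b2) (hc2 : ContDiff ℝ (⊤ : ℕ∞) c2)
    (ha : 0 < a) (hc10 : 0 < c1 0) (hc30 : 0 < c3 0)
    (T : Matrix (Fin 3) (Fin 3) ℝ) (hT : T * T.transpose = 1)
    (σ σInv : ℝ × ℝ → ℝ × ℝ) (U V : Set (ℝ × ℝ))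
    (hU : IsOpen U) (hV : IsOpen V) (hU0 : (0 : ℝ × ℝ) ∈ U) (hV0 : (0 : ℝ × ℝ) ∈ V)
    (hσ : ContDiffOn ℝ (⊤ : ℕ∞) σ U) (hσInv : ContDiffOn ℝ (⊤ : ℕ∞) σInv V)
    (hmaps : Set.MapsTo σ U V) (hmaps' : Set.MapsTo σInv V U)
    (hinv : ∀ p ∈ U, σInv (σ p) = p) (hinv' : ∀ p ∈ V, σ (σInv p) = p)
    (hσ0 : σ 0 = 0)
    (heq : ∀ p ∈ U, T.mulVec (NF a b1 b3 c1 c3 b2 c2 (σ p)) = NF a b1 b3 c1 c3 b2 c2 p) :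
    T = 1 ∨ T = Matrix.diagonal ![1, 1, -1] ∨ T = Matrix.diagonal ![-1, 1, 1] ∨
      T = Matrix.diagonal ![-1, 1, -1] := by
  have hI0 : σInv 0 = 0 := by
    have := hinv 0 hU0
    rwa [hσ0] at this
  have hdiff : DifferentiableAt ℝ σInv 0 :=
    (hσInv.contDiffAt (hV.mem_nhds hV0)).differentiableAt (by simp)
  set B := fderiv ℝ σInv 0 with hB
  have key : ∀ z : ℝ × ℝ,
      T 0 0 * (z.1 ^ 2 - z.2 ^ 2) + T 0 1 * (a * (z.1 ^ 2 + z.2 ^ 2)) = (B z).1 ^ 2 - (B z).2 ^ 2 ∧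
      T 1 0 * (z.1 ^ 2 - z.2 ^ 2) + T 1 1 * (a * (z.1 ^ 2 + z.2 ^ 2))
        = a * ((B z).1 ^ 2 + (B z).2 ^ 2) ∧
      T 2 0 * (z.1 ^ 2 - z.2 ^ 2) + T 2 1 * (a * (z.1 ^ 2 + z.2 ^ 2)) = 0 := by
    intro z
    have hl : HasDerivAt (fun t : ℝ => t • z) z 0 := by
      simpa using (hasDerivAt_id (0 : ℝ)).smul_const z
    have hl2 : HasDerivAt (fun t : ℝ => σInv (t • z)) (B z) 0 := by
      have h0 : HasFDerivAt σInv B ((0 : ℝ) • z) := by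
        rw [zero_smul]; exact hdiff.hasFDerivAt
      exact h0.comp_hasDerivAt (0 : ℝ) hl
    obtain ⟨p0, p1, p2⟩ := NF_lim a b1 b3 c1 c3 b2 c2 hb1.continuous hb3.continuous
      hc1s.continuous hc3s.continuous hb2.continuous hc2.continuous _ _ (by simp) hl
    obtain ⟨q0, q1, q2⟩ := NF_lim a b1 b3 c1 c3 b2 c2 hb1.continuous hb3.continuous
      hc1s.continuous hc3s.continuous hb2.continuous hc2.continuous _ _ (by simp [hI0]) hl2
    have hev : ∀ᶠ t : ℝ in 𝓝[≠] 0, t • z ∈ V := by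
      have : Tendsto (fun t : ℝ => t • z) (𝓝 0) (𝓝 0) := by
        simpa using hl.continuousAt.tendsto
      exact (this.mono_left nhdsWithin_le_nhds).eventually (hV.mem_nhds hV0)
    have hrow : ∀ i : Fin 3, ∀ᶠ t : ℝ in 𝓝[≠] 0,
        T i 0 * (NF a b1 b3 c1 c3 b2 c2 (t • z) 0 / t ^ 2) +
        T i 1 * (NF a b1 b3 c1 c3 b2 c2 (t • z) 1 / t ^ 2) +
        T i 2 * (NF a b1 b3 c1 c3 b2 c2 (t • z) 2 / t ^ 2)
          = NF a b1 b3 c1 c3 b2 c2 (σInv (t • z)) i / t ^ 2 := by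
      intro i
      filter_upwards [hev] with t ht
      have := congrFun (heq _ (hmaps' ht)) i
      rw [hinv' _ ht] at this
      rw [← this]
      simp only [Matrix.mulVec, dotProduct, Fin.sum_univ_three]
      ring
    have hL : ∀ i : Fin 3, Tendsto (fun t : ℝ => NF a b1 b3 c1 c3 b2 c2 (σInv (t • z)) i / t ^ 2)
        (𝓝[≠] 0) (𝓝 (T i 0 * (z.1 ^ 2 - z.2 ^ 2) + T i 1 * (a * (z.1 ^ 2 + z.2 ^ 2)))) := by
      intro i
      have := ((p0.const_mul (T i 0)).add (p1.const_mul (T i 1))).add (p2.const_mul (T i 2))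
      rw [mul_zero, add_zero] at this
      exact this.congr' (hrow i)
    exact ⟨tendsto_nhds_unique (hL 0) q0, tendsto_nhds_unique (hL 1) q1,
      tendsto_nhds_unique (hL 2) q2⟩
  have k1 := key (1, 0)
  have k2 := key (0, 1)
  have k3 := key (1, 1)
  have hsum : B (1, 1) = B (1, 0) + B (0, 1) := by rw [← map_add]; simp
  rw [hsum] at k3
  simp only [Prod.fst_add, Prod.snd_add] at k3
  generalize (B (1, 0)).1 = α at *
  generalize (B (1, 0)).2 = γ at *
  generalize (B (0, 1)).1 = β at *
  generalize (B (0, 1)).2 = δ at *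
  obtain ⟨k10, k11, k12⟩ := k1
  obtain ⟨k20, k21, k22⟩ := k2
  obtain ⟨k30, k31, -⟩ := k3
  have o : ∀ i j : Fin 3, T i 0 * T j 0 + T i 1 * T j 1 + T i 2 * T j 2
      = (1 : Matrix (Fin 3) (Fin 3) ℝ) i j := by
    intro i j
    rw [← hT]
    simp [Matrix.mul_apply, Fin.sum_univ_three]
  have o00 := o 0 0
  have o01 := o 0 1
  have o02 := o 0 2
  have o11 := o 1 1
  have o12 := o 1 2
  have o22 := o 2 2
  simp at o00 o01 o02 o11 o12 o22
  have hT' : T = !![T 0 0, T 0 1, T 0 2; T 1 0, T 1 1, T 1 2; T 2 0, T 2 1, T 2 2] :=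
    Matrix.eta_fin_three T
  generalize T 0 0 = t00 at *
  generalize T 0 1 = t01 at *
  generalize T 0 2 = t02 at *
  generalize T 1 0 = t10 at *
  generalize T 1 1 = t11 at *
  generalize T 1 2 = t12 at *
  generalize T 2 0 = t20 at *
  generalize T 2 1 = t21 at *
  generalize T 2 2 = t22 at *
  simp at k10 k11 k12 k20 k21 k22 k30 k31
  have z20 : t20 = 0 := by linarith
  subst z20
  have z21 : t21 = 0 := by
    have : t21 * a = 0 := by linarith
    exact (mul_eq_zero.1 this).resolve_right ha.ne'
  subst z21
  have h22 : t22 = 1 ∨ t22 = -1 := by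
    exact mul_self_eq_one_iff.1 (by linarith)
  have z22 : t22 ≠ 0 := by rcases h22 with h | h <;> rw [h] <;> norm_num
  have z02 : t02 = 0 := by simpa [z22] using o02
  have z12 : t12 = 0 := by simpa [z22] using o12
  subst z02 z12
  have m1 : α * β - γ * δ = 0 := by linarith
  have m2 : α * β + γ * δ = 0 := by
    have : a * (α * β + γ * δ) = 0 := by linarith
    exact (mul_eq_zero.1 this).resolve_left ha.ne'
  have m3 : α * β = 0 := by linarith
  have m4 : γ * δ = 0 := by linarith
  have main : (t00 = 1 ∨ t00 = -1) ∧ t01 = 0 ∧ t10 = 0 ∧ t11 = 1 := by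
    have hpos : 0 ≤ t11 := by
      have : t11 * a = a * (α ^ 2 + γ ^ 2 + β ^ 2 + δ ^ 2) / 2 := by linarith
      have h2 : 0 ≤ t11 * a := by rw [this]; positivity
      exact nonneg_of_mul_nonneg_left h2 ha
    have hap : a ^ 2 + 1 ≠ 0 := by positivity
    have fin : t01 = 0 → t10 = 0 → (t00 = 1 ∨ t00 = -1) ∧ t01 = 0 ∧ t10 = 0 ∧ t11 = 1 := by
      rintro rfl rfl
      refine ⟨mul_self_eq_one_iff.1 (by linarith), rfl, rfl, ?_⟩
      rcases mul_self_eq_one_iff.1 (show t11 * t11 = 1 by linarith) with h | h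
      · exact h
      · linarith
    rcases mul_eq_zero.1 m3 with rfl | rfl <;> rcases mul_eq_zero.1 m4 with rfl | rfl
    · exfalso
      have e0 : t00 = -(a * t01) := by linarith
      have e1 : t10 = -(a * t11) := by linarith
      subst e0 e1
      have : (t01 * t11) * (a ^ 2 + 1) = 0 := by linarith
      rcases mul_eq_zero.1 ((mul_eq_zero.1 this).resolve_right hap) with rfl | rfl
      · norm_num at o00
      · norm_num at o11
    · have e0 : t11 = -t00 := by
        have : a * (t11 + t00) = 0 := by linear_combination (k11 + k21) / 2 + a * (k10 - k20) / 2
        linarith [(mul_eq_zero.1 this).resolve_left ha.ne']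
      have e1 : t10 = -(a ^ 2 * t01) := by
        linear_combination (k11 - k21) / 2 + a * (k10 + k20) / 2
      have : (t00 * t01) * (a ^ 2 + 1) = 0 := by
        rw [e0, e1] at o01; linarith
      rcases mul_eq_zero.1 ((mul_eq_zero.1 this).resolve_right hap) with h | h
      · exfalso
        have q1 : t01 * a = 0 := by nlinarith [sq_nonneg β, sq_nonneg γ]
        have q2 := (mul_eq_zero.1 q1).resolve_right ha.ne'
        rw [h, q2] at o00
        norm_num at o00
      · exact fin h (by rw [e1, h]; ring)
    · have e0 : t11 = t00 := by
        have : a * (t11 - t00) = 0 := by linear_combination (k11 + k21) / 2 - a * (k10 - k20) / 2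
        linarith [(mul_eq_zero.1 this).resolve_left ha.ne']
      have e1 : t10 = a ^ 2 * t01 := by
        linear_combination (k11 - k21) / 2 - a * (k10 + k20) / 2
      have : (t00 * t01) * (a ^ 2 + 1) = 0 := by
        rw [e0, e1] at o01; linarith
      rcases mul_eq_zero.1 ((mul_eq_zero.1 this).resolve_right hap) with h | h
      · exfalso
        have q1 : t01 * a = 0 := by nlinarith [sq_nonneg α, sq_nonneg δ]
        have q2 := (mul_eq_zero.1 q1).resolve_right ha.ne'
        rw [h, q2] at o00
        norm_num at o00
      · exact fin h (by rw [e1, h]; ring)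
    · exfalso
      have e0 : t00 = a * t01 := by linarith
      have e1 : t10 = a * t11 := by linarith
      subst e0 e1
      have : (t01 * t11) * (a ^ 2 + 1) = 0 := by linarith
      rcases mul_eq_zero.1 ((mul_eq_zero.1 this).resolve_right hap) with rfl | rfl
      · norm_num at o00
      · norm_num at o11
  obtain ⟨h00, rfl, rfl, rfl⟩ := main
  rcases h00 with rfl | rfl <;> rcases h22 with rfl | rfl
  · left; rw [hT']; ext i j; fin_cases i <;> fin_cases j <;> simp
  · right; left; rw [hT']; ext i j; fin_cases i <;> fin_cases j <;> simp
  · right; right; left; rw [hT']; ext i j; fin_cases i <;> fin_cases j <;> simp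
  · right; right; right; rw [hT']; ext i j; fin_cases i <;> fin_cases j <;> simp
end
end

section
/- Fix the D₄⁺ normal form f with a > 0 and, for x = (x₁,x₂,x₃) ∈ ℝ³, let d_x(u,v) = ‖x − f(u,v)‖²/2 be the distance squared function. Then for every x, the gradient of d_x vanishes at (0,0), and the Hessian matrix of d_x at (0,0) is diag(−2(x₁ + a x₂), 2(x₁ − a x₂)). Consequently, det Hess d_x(0,0) = 0 if and only if x₁ = a x₂ or x₁ = −a x₂; i.e., the focal locus of f at the origin is the union of the two planes {x₁ = −a x₂} and {x₁ = a x₂}. -/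
open Real Filter Topology

noncomputable section

lemma aux_deriv (h K : ℝ → ℝ) (A : ℝ) (hK : ContDiff ℝ (⊤ : ℕ∞) K)
    (e : ∀ u, h u = A + u ^ 2 * K u) (u : ℝ) :
    deriv h u = 2 * u * K u + u ^ 2 * deriv K u := by
  have hd : Differentiable ℝ K := hK.differentiable (by simp)
  have he : h = fun u => A + u ^ 2 * K u := funext e
  have h1 : HasDerivAt (fun u : ℝ => A + u ^ 2 * K u)
      (((2 : ℕ) : ℝ) * u ^ (2 - 1) * K u + u ^ 2 * deriv K u) u :=
    ((hasDerivAt_pow 2 u).mul (hd u).hasDerivAt).const_add A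
  rw [he, h1.deriv]
  norm_num

lemma aux_deriv0 (h K : ℝ → ℝ) (A : ℝ) (hK : ContDiff ℝ (⊤ : ℕ∞) K)
    (e : ∀ u, h u = A + u ^ 2 * K u) : deriv h 0 = 0 := by
  rw [aux_deriv h K A hK e]; simp

lemma aux_deriv2 (h K : ℝ → ℝ) (A : ℝ) (hK : ContDiff ℝ (⊤ : ℕ∞) K)
    (e : ∀ u, h u = A + u ^ 2 * K u) : deriv (fun u => deriv h u) 0 = 2 * K 0 := by
  have hd : Differentiable ℝ K := hK.differentiable (by simp)
  have hK' : ContDiff ℝ (⊤ : ℕ∞) (deriv K) := (contDiff_infty_iff_deriv.1 hK).2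
  have hd' : Differentiable ℝ (deriv K) := hK'.differentiable (by simp)
  have he : (fun u => deriv h u) = fun u => 2 * u * K u + u ^ 2 * deriv K u :=
    funext (aux_deriv h K A hK e)
  have h2 : HasDerivAt (fun u : ℝ => 2 * u) (2 * 1) 0 := (hasDerivAt_id (0 : ℝ)).const_mul 2
  have h1 := (h2.mul (hd 0).hasDerivAt).add
    ((hasDerivAt_pow 2 (0 : ℝ)).mul (hd' 0).hasDerivAt)
  rw [he]
  refine h1.deriv.trans ?_
  norm_num

/-- the focal locus of the `D₄⁺` normal form at the origin is the
union of the two planes `x₁ = ±a x₂`. -/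
theorem stmt_15     (a : ℝ) (b1 b3 c1 c3 : ℝ → ℝ) (b2 c2 : ℝ × ℝ → ℝ)
    (hb1 : ContDiff ℝ (⊤ : ℕ∞) b1) (hb3 : ContDiff ℝ (⊤ : ℕ∞) b3)
    (hc1s : ContDiff ℝ (⊤ : ℕ∞) c1) (hc3s : ContDiff ℝ (⊤ : ℕ∞) c3)
    (hb2 : ContDiff ℝ (⊤ : ℕ∞) b2) (hc2 : ContDiff ℝ (⊤ : ℕ∞) c2)
    (ha : 0 < a) (x : Fin 3 → ℝ) :
    pd1 (dsq (NF a b1 b3 c1 c3 b2 c2) x) 0 = 0 ∧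
    pd2 (dsq (NF a b1 b3 c1 c3 b2 c2) x) 0 = 0 ∧
    (!![pd1 (pd1 (dsq (NF a b1 b3 c1 c3 b2 c2) x)) 0,
        pd2 (pd1 (dsq (NF a b1 b3 c1 c3 b2 c2) x)) 0;
        pd1 (pd2 (dsq (NF a b1 b3 c1 c3 b2 c2) x)) 0,
        pd2 (pd2 (dsq (NF a b1 b3 c1 c3 b2 c2) x)) 0] : Matrix (Fin 2) (Fin 2) ℝ) =
      Matrix.diagonal ![-2 * (x 0 + a * x 1), 2 * (x 0 - a * x 1)] ∧
    ((Matrix.diagonal ![-2 * (x 0 + a * x 1), 2 * (x 0 - a * x 1)] :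
        Matrix (Fin 2) (Fin 2) ℝ).det = 0 ↔ x 0 = a * x 1 ∨ x 0 = -(a * x 1)) := by
  have hu : ∀ v : ℝ, ∃ (K : ℝ → ℝ) (A : ℝ), ContDiff ℝ (⊤ : ℕ∞) K ∧
      (∀ u, dsq (NF a b1 b3 c1 c3 b2 c2) x (u, v) = A + u ^ 2 * K u) ∧
      (v = 0 → K 0 = -(x 0 + a * x 1)) := by
    intro v
    refine ⟨fun u => -(x 0 + v ^ 2) + u ^ 2 / 2
        + (-(x 1 - a * v ^ 2 - v ^ 3 * b3 v) * (a + u * b1 u + v ^ 2 * b2 (u, v))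
          + u ^ 2 * (a + u * b1 u + v ^ 2 * b2 (u, v)) ^ 2 / 2)
        + (-(x 2 - v ^ 3 * c3 v) * (u * c1 u + v ^ 2 * c2 (u, v))
          + u ^ 2 * (u * c1 u + v ^ 2 * c2 (u, v)) ^ 2 / 2),
      ((x 0 + v ^ 2) ^ 2 + (x 1 - a * v ^ 2 - v ^ 3 * b3 v) ^ 2 + (x 2 - v ^ 3 * c3 v) ^ 2) / 2,
      ?_, ?_, ?_⟩
    · have hb : ContDiff ℝ (⊤ : ℕ∞) fun u : ℝ => b2 (u, v) :=
        hb2.comp (contDiff_id.prodMk contDiff_const)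
      have hc : ContDiff ℝ (⊤ : ℕ∞) fun u : ℝ => c2 (u, v) :=
        hc2.comp (contDiff_id.prodMk contDiff_const)
      fun_prop
    · intro u
      simp [dsq, dot3, NF, BC]
      ring
    · rintro rfl
      simp
      ring
  have hv : ∀ u : ℝ, ∃ (K : ℝ → ℝ) (A : ℝ), ContDiff ℝ (⊤ : ℕ∞) K ∧
      (∀ v, dsq (NF a b1 b3 c1 c3 b2 c2) x (u, v) = A + v ^ 2 * K v) ∧
      (u = 0 → K 0 = x 0 - a * x 1) := by
    intro u
    refine ⟨fun v => (x 0 - u ^ 2) + v ^ 2 / 2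
        + (-(x 1 - a * u ^ 2 - u ^ 3 * b1 u) * (a + v * b3 v + u ^ 2 * b2 (u, v))
          + v ^ 2 * (a + v * b3 v + u ^ 2 * b2 (u, v)) ^ 2 / 2)
        + (-(x 2 - u ^ 3 * c1 u) * (v * c3 v + u ^ 2 * c2 (u, v))
          + v ^ 2 * (v * c3 v + u ^ 2 * c2 (u, v)) ^ 2 / 2),
      ((x 0 - u ^ 2) ^ 2 + (x 1 - a * u ^ 2 - u ^ 3 * b1 u) ^ 2 + (x 2 - u ^ 3 * c1 u) ^ 2) / 2,
      ?_, ?_, ?_⟩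
    · have hb : ContDiff ℝ (⊤ : ℕ∞) fun v : ℝ => b2 (u, v) :=
        hb2.comp (contDiff_const.prodMk contDiff_id)
      have hc : ContDiff ℝ (⊤ : ℕ∞) fun v : ℝ => c2 (u, v) :=
        hc2.comp (contDiff_const.prodMk contDiff_id)
      fun_prop
    · intro v
      simp [dsq, dot3, NF, BC]
      ring
    · rintro rfl
      simp
      ring
  have p1 : ∀ v : ℝ, pd1 (dsq (NF a b1 b3 c1 c3 b2 c2) x) (0, v) = 0 := by
    intro v
    obtain ⟨K, A, hK, e, -⟩ := hu v
    exact aux_deriv0 _ K A hK e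
  have p2 : ∀ u : ℝ, pd2 (dsq (NF a b1 b3 c1 c3 b2 c2) x) (u, 0) = 0 := by
    intro u
    obtain ⟨K, A, hK, e, -⟩ := hv u
    exact aux_deriv0 _ K A hK e
  have p11 : pd1 (pd1 (dsq (NF a b1 b3 c1 c3 b2 c2) x)) 0 = -2 * (x 0 + a * x 1) := by
    obtain ⟨K, A, hK, e, h0⟩ := hu 0
    refine (aux_deriv2 _ K A hK e).trans ?_
    rw [h0 rfl]; ring
  have p22 : pd2 (pd2 (dsq (NF a b1 b3 c1 c3 b2 c2) x)) 0 = 2 * (x 0 - a * x 1) := by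
    obtain ⟨K, A, hK, e, h0⟩ := hv 0
    refine (aux_deriv2 _ K A hK e).trans ?_
    rw [h0 rfl]
  have p12 : pd2 (pd1 (dsq (NF a b1 b3 c1 c3 b2 c2) x)) 0 = 0 := by
    change deriv (fun v => pd1 (dsq (NF a b1 b3 c1 c3 b2 c2) x) (0, v)) 0 = 0
    simp [p1]
  have p21 : pd1 (pd2 (dsq (NF a b1 b3 c1 c3 b2 c2) x)) 0 = 0 := by
    change deriv (fun u => pd2 (dsq (NF a b1 b3 c1 c3 b2 c2) x) (u, 0)) 0 = 0
    simp [p2]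
  refine ⟨p1 0, p2 0, ?_, ?_⟩
  · rw [p11, p22, p12, p21]
    ext i j
    fin_cases i <;> fin_cases j <;> simp
  · rw [Matrix.det_diagonal, Fin.prod_univ_two]
    simp only [Matrix.cons_val_zero, Matrix.cons_val_one, mul_eq_zero]
    constructor
    · rintro ((h | h) | (h | h))
      · norm_num at h
      · right; linarith
      · norm_num at h
      · left; linarith
    · rintro (h | h)
      · right; right; linarith
      · left; right; linarith
end
end

section
/- Fix the D₄⁺ normal form f with a > 0 and let d_x(u,v) = ‖x − f(u,v)‖²/2 for x = (x₁,x₂,x₃) ∈ ℝ³. Suppose x₁ = −a x₂ and x₂ ≠ 0. Then d_x has a critical point at (0,0) whose Hessian matrix is diag(0, −4 a x₂), which has rank one with kernel spanned by ∂/∂u, and the third derivative in the kernel direction is ∂³d_x/∂u³(0,0) = −6(x₂ b₁(0) + x₃ c₁(0)). In particular, if c₁(0) ≠ 0, this third derivative is nonzero if and only if x₃ ≠ −x₂ b₁(0)/c₁(0) (the condition for d_x to have an A₂-singularity at the origin). -/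
open Real Filter Topology

noncomputable section

theorem aux_jet (φ h : ℝ → ℝ) (K q : ℝ) (hh : ContDiff ℝ (⊤ : ℕ∞) h)
    (hφ : ∀ t, φ t = K + q * t ^ 2 + t ^ 3 * h t) :
    deriv φ 0 = 0 ∧ deriv (deriv φ) 0 = 2 * q ∧ iteratedDeriv 3 φ 0 = 6 * q * 0 + 6 * h 0 := by
  have e0 : φ = fun t => K + q * t ^ 2 + t ^ 3 * h t := funext hφ
  have h1 : ContDiff ℝ (⊤ : ℕ∞) (deriv h) := (contDiff_infty_iff_deriv.1 hh).2
  have h2 : ContDiff ℝ (⊤ : ℕ∞) (deriv (deriv h)) := (contDiff_infty_iff_deriv.1 h1).2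
  have d0 : ∀ t, HasDerivAt h (deriv h t) t := fun t => (hh.differentiable (by simp) t).hasDerivAt
  have d1 : ∀ t, HasDerivAt (deriv h) (deriv (deriv h) t) t :=
    fun t => (h1.differentiable (by simp) t).hasDerivAt
  have d2 : ∀ t, HasDerivAt (deriv (deriv h)) (deriv (deriv (deriv h)) t) t :=
    fun t => (h2.differentiable (by simp) t).hasDerivAt
  have e1 : deriv φ = fun t => 2 * q * t + (3 * t ^ 2 * h t + t ^ 3 * deriv h t) := by
    funext t
    rw [e0]
    refine HasDerivAt.deriv ?_
    refine HasDerivAt.congr_deriv (f := _) (((((hasDerivAt_id t).pow 2).const_mul q).const_add K).add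
      (((hasDerivAt_id t).pow 3).mul (d0 t))) ?_
    simp; ring
  have e2 : deriv (deriv φ) = fun t => 2 * q + (6 * t * h t + 6 * t ^ 2 * deriv h t
      + t ^ 3 * deriv (deriv h) t) := by
    funext t
    rw [e1]
    refine HasDerivAt.deriv ?_
    refine HasDerivAt.congr_deriv (f := _) (((hasDerivAt_id t).const_mul (2 * q)).add
      (((((hasDerivAt_id t).pow 2).const_mul 3).mul (d0 t)).add
        (((hasDerivAt_id t).pow 3).mul (d1 t)))) ?_
    simp; ring
  have e3 : deriv (deriv (deriv φ)) 0 = 6 * h 0 := by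
    rw [e2]
    refine HasDerivAt.deriv ?_
    refine HasDerivAt.congr_deriv (f := _) ((((((hasDerivAt_id (0:ℝ)).const_mul 6).mul (d0 0)).add
      ((((hasDerivAt_id (0:ℝ)).pow 2).const_mul 6).mul (d1 0))).add
        (((hasDerivAt_id (0:ℝ)).pow 3).mul (d2 0))).const_add (2 * q)) ?_
    simp
  refine ⟨by rw [e1]; simp, by rw [e2]; simp, ?_⟩
  simp only [iteratedDeriv_succ, iteratedDeriv_zero]
  rw [e3]; ring

theorem aux_sq (φ G : ℝ → ℝ) (A : ℝ) (hG : Differentiable ℝ G)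
    (hφ : ∀ t, φ t = A + t ^ 2 * G t) : deriv φ 0 = 0 := by
  have e0 : φ = fun t => A + t ^ 2 * G t := funext hφ
  rw [e0]
  refine HasDerivAt.deriv ?_
  refine HasDerivAt.congr_deriv (f := _) ((((hasDerivAt_id (0:ℝ)).pow 2).mul (hG 0).hasDerivAt).const_add A) ?_
  simp

/-- the `A₂`-condition for the distance squared function on the focal
plane `x₁ = −a x₂`. -/
theorem stmt_16     (a : ℝ) (b1 b3 c1 c3 : ℝ → ℝ) (b2 c2 : ℝ × ℝ → ℝ)
    (hb1 : ContDiff ℝ (⊤ : ℕ∞) b1) (hb3 : ContDiff ℝ (⊤ : ℕ∞) b3)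
    (hc1s : ContDiff ℝ (⊤ : ℕ∞) c1) (hc3s : ContDiff ℝ (⊤ : ℕ∞) c3)
    (hb2 : ContDiff ℝ (⊤ : ℕ∞) b2) (hc2 : ContDiff ℝ (⊤ : ℕ∞) c2)
    (ha : 0 < a) (x : Fin 3 → ℝ)
    (hx1 : x 0 = -(a * x 1)) (hx2 : x 1 ≠ 0) :
    pd1 (dsq (NF a b1 b3 c1 c3 b2 c2) x) 0 = 0 ∧
    pd2 (dsq (NF a b1 b3 c1 c3 b2 c2) x) 0 = 0 ∧
    (!![pd1 (pd1 (dsq (NF a b1 b3 c1 c3 b2 c2) x)) 0,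
        pd2 (pd1 (dsq (NF a b1 b3 c1 c3 b2 c2) x)) 0;
        pd1 (pd2 (dsq (NF a b1 b3 c1 c3 b2 c2) x)) 0,
        pd2 (pd2 (dsq (NF a b1 b3 c1 c3 b2 c2) x)) 0] : Matrix (Fin 2) (Fin 2) ℝ) =
      Matrix.diagonal ![0, -4 * a * x 1] ∧
    (Matrix.diagonal ![0, -4 * a * x 1] : Matrix (Fin 2) (Fin 2) ℝ).rank = 1 ∧
    (Matrix.diagonal ![0, -4 * a * x 1] : Matrix (Fin 2) (Fin 2) ℝ).mulVec ![1, 0] = 0 ∧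
    iteratedDeriv 3 (fun u : ℝ => dsq (NF a b1 b3 c1 c3 b2 c2) x (u, 0)) 0 =
      -6 * (x 1 * b1 0 + x 2 * c1 0) ∧
    (c1 0 ≠ 0 →
      (iteratedDeriv 3 (fun u : ℝ => dsq (NF a b1 b3 c1 c3 b2 c2) x (u, 0)) 0 ≠ 0 ↔
        x 2 ≠ -(x 1 * b1 0) / c1 0)) := by
  have Db1 : Differentiable ℝ b1 := hb1.differentiable (by simp)
  have Db3 : Differentiable ℝ b3 := hb3.differentiable (by simp)
  have Dc1 : Differentiable ℝ c1 := hc1s.differentiable (by simp)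
  have Dc3 : Differentiable ℝ c3 := hc3s.differentiable (by simp)
  have Db2 : Differentiable ℝ b2 := hb2.differentiable (by simp)
  have Dc2 : Differentiable ℝ c2 := hc2.differentiable (by simp)
  have J1 := aux_jet (fun u : ℝ => dsq (NF a b1 b3 c1 c3 b2 c2) x (u, 0))
    (fun u => -(x 1 * b1 u + x 2 * c1 u) + u * ((1 + a ^ 2) / 2) + a * u ^ 2 * b1 u
      + u ^ 3 * ((b1 u) ^ 2 + (c1 u) ^ 2) / 2) ((x 0 ^ 2 + x 1 ^ 2 + x 2 ^ 2) / 2) 0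
    (by fun_prop) (by
      intro t
      simp [dsq, NF, BC, dot3, hx1]
      ring)
  have J2 := aux_jet (fun v : ℝ => dsq (NF a b1 b3 c1 c3 b2 c2) x (0, v))
    (fun u => -(x 1 * b3 u + x 2 * c3 u) + u * ((1 + a ^ 2) / 2) + a * u ^ 2 * b3 u
      + u ^ 3 * ((b3 u) ^ 2 + (c3 u) ^ 2) / 2) ((x 0 ^ 2 + x 1 ^ 2 + x 2 ^ 2) / 2)
    (-2 * a * x 1)
    (by fun_prop) (by
      intro t
      simp [dsq, NF, BC, dot3, hx1]
      ring)
  have M1 : ∀ v : ℝ, deriv (fun u : ℝ => dsq (NF a b1 b3 c1 c3 b2 c2) x (u, v)) 0 = 0 := by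
    intro v
    refine aux_sq _ (fun u => (-2 * (x 0 + v ^ 2) + u ^ 2
      + (-2 * (x 1 - a * v ^ 2 - v ^ 3 * b3 v) * (a + u * b1 u + v ^ 2 * b2 (u, v))
        + u ^ 2 * (a + u * b1 u + v ^ 2 * b2 (u, v)) ^ 2)
      + (-2 * (x 2 - v ^ 3 * c3 v) * (u * c1 u + v ^ 2 * c2 (u, v))
        + u ^ 2 * (u * c1 u + v ^ 2 * c2 (u, v)) ^ 2)) / 2)
      (((x 0 + v ^ 2) ^ 2 + (x 1 - a * v ^ 2 - v ^ 3 * b3 v) ^ 2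
        + (x 2 - v ^ 3 * c3 v) ^ 2) / 2) (by fun_prop) ?_
    intro t
    simp [dsq, NF, BC, dot3]
    ring
  have M2 : ∀ u : ℝ, deriv (fun v : ℝ => dsq (NF a b1 b3 c1 c3 b2 c2) x (u, v)) 0 = 0 := by
    intro v
    refine aux_sq _ (fun u => (2 * (x 0 - v ^ 2) + u ^ 2
      + (-2 * (x 1 - a * v ^ 2 - v ^ 3 * b1 v) * (a + u * b3 u + v ^ 2 * b2 (v, u))
        + u ^ 2 * (a + u * b3 u + v ^ 2 * b2 (v, u)) ^ 2)
      + (-2 * (x 2 - v ^ 3 * c1 v) * (u * c3 u + v ^ 2 * c2 (v, u))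
        + u ^ 2 * (u * c3 u + v ^ 2 * c2 (v, u)) ^ 2)) / 2)
      (((x 0 - v ^ 2) ^ 2 + (x 1 - a * v ^ 2 - v ^ 3 * b1 v) ^ 2
        + (x 2 - v ^ 3 * c1 v) ^ 2) / 2) (by fun_prop) ?_
    intro t
    simp [dsq, NF, BC, dot3]
    ring
  have I3 : iteratedDeriv 3 (fun u : ℝ => dsq (NF a b1 b3 c1 c3 b2 c2) x (u, 0)) 0 =
      -6 * (x 1 * b1 0 + x 2 * c1 0) := by
    rw [J1.2.2]; simp; ring
  have P11 : pd1 (pd1 (dsq (NF a b1 b3 c1 c3 b2 c2) x)) 0 = 0 := J1.2.1.trans (by ring)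
  have P22 : pd2 (pd2 (dsq (NF a b1 b3 c1 c3 b2 c2) x)) 0 = -4 * a * x 1 :=
    J2.2.1.trans (by ring)
  have P12 : pd2 (pd1 (dsq (NF a b1 b3 c1 c3 b2 c2) x)) 0 = 0 := by
    simp only [pd1, pd2, Prod.fst_zero, M1, deriv_const]
  have P21 : pd1 (pd2 (dsq (NF a b1 b3 c1 c3 b2 c2) x)) 0 = 0 := by
    simp only [pd1, pd2, Prod.snd_zero, M2, deriv_const]
  refine ⟨J1.1, J2.1, ?_, ?_, ?_, I3, ?_⟩
  · rw [P11, P22, P12, P21]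
    ext i j
    fin_cases i <;> fin_cases j <;> simp
  · rw [Matrix.rank_diagonal, Fintype.card_eq_one_iff]
    refine ⟨⟨1, by simp [hx2, ha.ne']⟩, ?_⟩
    rintro ⟨i, hi⟩
    fin_cases i
    · simp at hi
    · rfl
  · ext i
    fin_cases i <;> simp [Matrix.mulVec_diagonal]
  · intro hc
    rw [I3, not_iff_not, eq_div_iff hc]
    constructor <;> intro h <;> linarith
end
end

section
/- Fix the D₄⁺ normal form f with a > 0 and let d_x(u,v) = ‖x − f(u,v)‖²/2 for x = (0, 0, x₃) with x₃ ∈ ℝ. Then all partial derivatives of d_x − d_x(0,0) at (0,0) of order ≤ 2 vanish, and the third-order Taylor polynomial of d_x at (0,0) equals d_x(0,0) − x₃(c₁(0) u³ + c₃(0) v³); equivalently ∂³d_x/∂u³(0,0) = −6 x₃ c₁(0), ∂³d_x/∂v³(0,0) = −6 x₃ c₃(0), and the mixed third derivatives ∂³d_x/∂u²∂v(0,0) and ∂³d_x/∂u∂v²(0,0) vanish. In particular, if x₃ ≠ 0 and c₁(0) > 0, c₃(0) > 0, the cubic part of d_x at the origin is a nondegenerate cubic equivalent to u³ + v³ (so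 d_x has a D₄⁺-singularity of functions). -/
open Real Filter Topology

noncomputable section

lemma flat_mul {j k m : ℕ} (f g : ℝ × ℝ → ℝ) (hf : ContDiff ℝ (⊤ : ℕ∞) f)
    (hg : ContDiff ℝ (⊤ : ℕ∞) g)
    (h1 : ∀ i < j, iteratedFDeriv ℝ i f 0 = 0) (h2 : ∀ i < k, iteratedFDeriv ℝ i g 0 = 0)
    (hm : m ≤ j + k) :
    ∀ i < m, iteratedFDeriv ℝ i (fun p => f p * g p) 0 = 0 := by
  intro i hi
  have h := norm_iteratedFDeriv_mul_le (𝕜 := ℝ) (n := i) hf hg (0 : ℝ × ℝ)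
    (by exact_mod_cast le_top)
  rw [Finset.sum_eq_zero] at h
  · exact norm_le_zero_iff.1 h
  · intro l hl
    rw [Finset.mem_range] at hl
    by_cases hlj : l < j
    · rw [h1 l hlj]; simp
    · rw [h2 (i - l) (by omega)]; simp

lemma flat_BC (g1 g3 : ℝ → ℝ) (g2 : ℝ × ℝ → ℝ)
    (h1 : ContDiff ℝ (⊤ : ℕ∞) g1) (h3 : ContDiff ℝ (⊤ : ℕ∞) g3)
    (h2 : ContDiff ℝ (⊤ : ℕ∞) g2) :
    ∀ i < 3, iteratedFDeriv ℝ i (BC g1 g3 g2) 0 = 0 := by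
  have z : ∀ (g : ℝ × ℝ → ℝ), ∀ i < 0, iteratedFDeriv ℝ i g 0 = 0 := by
    intro g i hi; omega
  have o : ∀ (g : ℝ × ℝ → ℝ), g 0 = 0 → ∀ i < 1, iteratedFDeriv ℝ i g 0 = 0 := by
    intro g hg i hi
    obtain rfl : i = 0 := by omega
    ext; simp [hg]
  have ou := o (fun p => p.1) rfl
  have ov := o (fun p => p.2) rfl
  have su : ContDiff ℝ (⊤ : ℕ∞) (fun p : ℝ × ℝ => p.1) := contDiff_fst
  have sv : ContDiff ℝ (⊤ : ℕ∞) (fun p : ℝ × ℝ => p.2) := contDiff_snd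
  have uu := flat_mul (m := 2) _ _ su su ou ou le_rfl
  have vv := flat_mul (m := 2) _ _ sv sv ov ov le_rfl
  have uuu := flat_mul (m := 3) _ _ (su.mul su) su uu ou le_rfl
  have vvv := flat_mul (m := 3) _ _ (sv.mul sv) sv vv ov le_rfl
  have uuvv := flat_mul (m := 3) _ _ (su.mul su) (sv.mul sv) uu vv (by norm_num)
  have A := flat_mul (m := 3) _ _ ((su.mul su).mul su) (h1.comp su) uuu (z _) le_rfl
  have B := flat_mul (m := 3) _ _ ((su.mul su).mul (sv.mul sv)) h2 uuvv (z _) le_rfl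
  have C := flat_mul (m := 3) _ _ ((sv.mul sv).mul sv) (h3.comp sv) vvv (z _) le_rfl
  have sA := ((su.mul su).mul su).mul (h1.comp su)
  have sB := ((su.mul su).mul (sv.mul sv)).mul h2
  have sC := ((sv.mul sv).mul sv).mul (h3.comp sv)
  intro i hi
  have e : BC g1 g3 g2 = ((fun p : ℝ × ℝ => p.1 * p.1 * p.1 * (g1 ∘ fun p : ℝ × ℝ => p.1) p) +
      (fun p : ℝ × ℝ => p.1 * p.1 * (p.2 * p.2) * g2 p)) +
      (fun p : ℝ × ℝ => p.2 * p.2 * p.2 * (g3 ∘ fun p : ℝ × ℝ => p.2) p) := by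
    funext p; simp [BC]; ring
  have le : ((i : ℕ∞) : WithTop ℕ∞) ≤ ((⊤ : ℕ∞) : WithTop ℕ∞) := by exact_mod_cast le_top
  have sAB : ContDiff ℝ (⊤ : ℕ∞)
      ((fun p : ℝ × ℝ => p.1 * p.1 * p.1 * (g1 ∘ fun p : ℝ × ℝ => p.1) p) +
      (fun p : ℝ × ℝ => p.1 * p.1 * (p.2 * p.2) * g2 p)) := sA.add sB
  rw [e, iteratedFDeriv_add (sAB.of_le le) (sC.of_le le),
    iteratedFDeriv_add (sA.of_le le) (sB.of_le le)]
  simp only [Pi.add_apply]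
  rw [A i hi, B i hi, C i hi]; simp

lemma d1_sq (k : ℝ) (h : ℝ → ℝ) (hh : ContDiff ℝ (⊤ : ℕ∞) h) :
    deriv (fun u => k + u ^ 2 * h u) = fun u => u * (2 * h u + u * deriv h u) := by
  funext u
  have hd : HasDerivAt h (deriv h u) u := (hh.differentiable (by simp) u).hasDerivAt
  have := (((hasDerivAt_id u).pow 2).mul hd).const_add k
  refine Eq.trans this.deriv ?_
  simp; ring

lemma deriv_smooth (h : ℝ → ℝ) (hh : ContDiff ℝ (⊤ : ℕ∞) h) :
    ContDiff ℝ (⊤ : ℕ∞) (deriv h) := (contDiff_infty_iff_deriv.1 hh).2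

lemma d1_mul (h : ℝ → ℝ) (hh : ContDiff ℝ (⊤ : ℕ∞) h) :
    deriv (fun u => u * h u) = fun u => h u + u * deriv h u := by
  funext u
  have hd : HasDerivAt h (deriv h u) u := (hh.differentiable (by simp) u).hasDerivAt
  refine Eq.trans ((hasDerivAt_id u).mul hd).deriv ?_
  simp

lemma d2_sq (k : ℝ) (h : ℝ → ℝ) (hh : ContDiff ℝ (⊤ : ℕ∞) h) :
    deriv (deriv (fun u => k + u ^ 2 * h u)) 0 = 2 * h 0 := by
  have := deriv_smooth h hh
  rw [d1_sq k h hh, d1_mul (fun u => 2 * h u + u * deriv h u) (by fun_prop)]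
  simp

lemma d3_cube (k : ℝ) (g : ℝ → ℝ) (hg : ContDiff ℝ (⊤ : ℕ∞) g) :
    deriv (deriv (deriv (fun u => k + u ^ 3 * g u))) 0 = 6 * g 0 := by
  have h' := deriv_smooth g hg
  have h'' := deriv_smooth _ h'
  have e : (fun u => k + u ^ 3 * g u) = fun u => k + u ^ 2 * (u * g u) := by funext u; ring
  have e2 : (fun u => u * (2 * (u * g u) + u * (g u + u * deriv g u))) =
      fun u => 0 + u ^ 2 * (3 * g u + u * deriv g u) := by funext u; ring
  rw [e, d1_sq k (fun u => u * g u) (by fun_prop), d1_mul g hg, e2,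
    d2_sq 0 (fun u => 3 * g u + u * deriv g u) (by fun_prop)]
  simp; ring

lemma dsq_eq (a : ℝ) (b1 b3 c1 c3 : ℝ → ℝ) (b2 c2 : ℝ × ℝ → ℝ)
    (hb1 : ContDiff ℝ (⊤ : ℕ∞) b1) (hb3 : ContDiff ℝ (⊤ : ℕ∞) b3)
    (hc1s : ContDiff ℝ (⊤ : ℕ∞) c1) (hc3s : ContDiff ℝ (⊤ : ℕ∞) c3)
    (hb2 : ContDiff ℝ (⊤ : ℕ∞) b2) (hc2 : ContDiff ℝ (⊤ : ℕ∞) c2) (x3 : ℝ) :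
    ∃ (g1 g3 : ℝ → ℝ) (g2 : ℝ × ℝ → ℝ), ContDiff ℝ (⊤ : ℕ∞) g1 ∧ ContDiff ℝ (⊤ : ℕ∞) g3 ∧
      ContDiff ℝ (⊤ : ℕ∞) g2 ∧ g1 0 = - x3 * c1 0 ∧ g3 0 = - x3 * c3 0 ∧
      dsq (NF a b1 b3 c1 c3 b2 c2) ![0, 0, x3] = fun p => x3 ^ 2 / 2 + BC g1 g3 g2 p := by
  refine ⟨fun u => (u + a ^ 2 * u + 2 * a * u ^ 2 * b1 u + u ^ 3 * b1 u ^ 2) / 2 - x3 * c1 u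
      + u ^ 3 * c1 u ^ 2 / 2,
    fun v => (v + a ^ 2 * v + 2 * a * v ^ 2 * b3 v + v ^ 3 * b3 v ^ 2) / 2 - x3 * c3 v
      + v ^ 3 * c3 v ^ 2 / 2,
    fun p => -1 + a ^ 2 + a * (p.1 * b1 p.1 + (p.1 ^ 2 + p.2 ^ 2) * b2 p + p.2 * b3 p.2)
      + (p.1 ^ 2 * p.2 ^ 2 * b2 p ^ 2 + 2 * p.1 ^ 3 * b1 p.1 * b2 p + 2 * p.2 ^ 3 * b3 p.2 * b2 p
        + 2 * p.1 * p.2 * b1 p.1 * b3 p.2) / 2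
      - x3 * c2 p
      + (p.1 ^ 2 * p.2 ^ 2 * c2 p ^ 2 + 2 * p.1 ^ 3 * c1 p.1 * c2 p + 2 * p.2 ^ 3 * c3 p.2 * c2 p
        + 2 * p.1 * p.2 * c1 p.1 * c3 p.2) / 2,
    by fun_prop, by fun_prop, by fun_prop, by simp, by simp, ?_⟩
  funext p
  simp [dsq, dot3, NF, BC]
  ring

lemma exists_cbrt (y : ℝ) (hy : y ≠ 0) : ∃ s : ℝ, s ≠ 0 ∧ s ^ 3 = y := by
  have key : ∀ y : ℝ, 0 < y → ∃ s : ℝ, s ^ 3 = y := fun y hy =>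
    ⟨y ^ ((3 : ℕ) : ℝ)⁻¹, Real.rpow_inv_natCast_pow hy.le (by norm_num)⟩
  have : ∃ s : ℝ, s ^ 3 = y := by
    rcases lt_or_gt_of_ne hy with h | h
    · obtain ⟨s, hs⟩ := key (-y) (by linarith)
      exact ⟨-s, by rw [Odd.neg_pow (by decide), hs]; ring⟩
    · exact key y h
  obtain ⟨s, hs⟩ := this
  exact ⟨s, by rintro rfl; apply hy; rw [← hs]; norm_num, hs⟩

/-- the distance squared function at a point of the `z`-axis has a
`D₄⁺`-singularity of functions. -/
theorem stmt_17     (a : ℝ) (b1 b3 c1 c3 : ℝ → ℝ) (b2 c2 : ℝ × ℝ → ℝ)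
    (hb1 : ContDiff ℝ (⊤ : ℕ∞) b1) (hb3 : ContDiff ℝ (⊤ : ℕ∞) b3)
    (hc1s : ContDiff ℝ (⊤ : ℕ∞) c1) (hc3s : ContDiff ℝ (⊤ : ℕ∞) c3)
    (hb2 : ContDiff ℝ (⊤ : ℕ∞) b2) (hc2 : ContDiff ℝ (⊤ : ℕ∞) c2)
    (ha : 0 < a) (x3 : ℝ) :
    (∀ n : ℕ, n ≤ 2 →
      iteratedFDeriv ℝ n
        (fun p : ℝ × ℝ => dsq (NF a b1 b3 c1 c3 b2 c2) ![0, 0, x3] p -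
          dsq (NF a b1 b3 c1 c3 b2 c2) ![0, 0, x3] 0) 0 = 0) ∧
    pd1 (pd1 (pd1 (dsq (NF a b1 b3 c1 c3 b2 c2) ![0, 0, x3]))) 0 = -6 * x3 * c1 0 ∧
    pd2 (pd2 (pd2 (dsq (NF a b1 b3 c1 c3 b2 c2) ![0, 0, x3]))) 0 = -6 * x3 * c3 0 ∧
    pd2 (pd1 (pd1 (dsq (NF a b1 b3 c1 c3 b2 c2) ![0, 0, x3]))) 0 = 0 ∧
    pd2 (pd2 (pd1 (dsq (NF a b1 b3 c1 c3 b2 c2) ![0, 0, x3]))) 0 = 0 ∧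
    (x3 ≠ 0 → 0 < c1 0 → 0 < c3 0 →
      ∃ s t : ℝ, s ≠ 0 ∧ t ≠ 0 ∧ ∀ u v : ℝ,
        -x3 * (c1 0 * u ^ 3 + c3 0 * v ^ 3) = (s * u) ^ 3 + (t * v) ^ 3) := by
  obtain ⟨g1, g3, g2, h1, h3, h2, e1, e3, e⟩ :=
    dsq_eq a b1 b3 c1 c3 b2 c2 hb1 hb3 hc1s hc3s hb2 hc2 x3
  rw [e]
  have hs : ∀ v, (fun u => x3 ^ 2 / 2 + BC g1 g3 g2 (u, v)) =
      fun u => (x3 ^ 2 / 2 + v ^ 3 * g3 v) + u ^ 2 * (u * g1 u + v ^ 2 * g2 (u, v)) := by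
    intro v; funext u; simp [BC]; ring
  refine ⟨?_, ?_, ?_, ?_, ?_, ?_⟩
  · intro n hn
    have : (fun p : ℝ × ℝ => x3 ^ 2 / 2 + BC g1 g3 g2 p - (x3 ^ 2 / 2 + BC g1 g3 g2 0)) =
        BC g1 g3 g2 := by
      funext p; simp [BC]
    rw [this]
    exact flat_BC g1 g3 g2 h1 h3 h2 n (by omega)
  · have := d3_cube (x3 ^ 2 / 2) g1 h1
    rw [e1] at this
    simp only [pd1, BC, Prod.fst_zero, Prod.snd_zero]
    simp only [ne_eq, OfNat.ofNat_ne_zero, not_false_eq_true, zero_pow, mul_zero, zero_mul,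
      add_zero]
    refine Eq.trans this ?_
    ring
  · have := d3_cube (x3 ^ 2 / 2) g3 h3
    rw [e3] at this
    simp only [pd2, BC, Prod.fst_zero, Prod.snd_zero]
    simp only [ne_eq, OfNat.ofNat_ne_zero, not_false_eq_true, zero_pow, mul_zero, zero_mul,
      zero_add]
    refine Eq.trans this ?_
    ring
  · simp only [pd1, pd2, Prod.fst_zero, Prod.snd_zero]
    have : ∀ v, deriv (deriv (fun u => x3 ^ 2 / 2 + BC g1 g3 g2 (u, v))) 0 =
        0 + v ^ 2 * (2 * g2 (0, v)) := by
      intro v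
      rw [hs v, d2_sq _ (fun u => u * g1 u + v ^ 2 * g2 (u, v)) (by fun_prop)]
      ring
    refine Eq.trans (congrArg (fun f => deriv f 0) (funext this)) ?_
    rw [d1_sq 0 (fun v => 2 * g2 (0, v)) (by fun_prop)]
    simp
  · simp only [pd1, pd2, Prod.fst_zero, Prod.snd_zero]
    have : ∀ v, deriv (fun u => x3 ^ 2 / 2 + BC g1 g3 g2 (u, v)) 0 = 0 := by
      intro v
      rw [hs v, d1_sq _ (fun u => u * g1 u + v ^ 2 * g2 (u, v)) (by fun_prop)]
      simp
    simp [this]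
  · intro hx p1 p3
    obtain ⟨s, hs0, hs⟩ := exists_cbrt (-x3 * c1 0) (mul_ne_zero (neg_ne_zero.2 hx) p1.ne')
    obtain ⟨t, ht0, ht⟩ := exists_cbrt (-x3 * c3 0) (mul_ne_zero (neg_ne_zero.2 hx) p3.ne')
    refine ⟨s, t, hs0, ht0, fun u v => ?_⟩
    rw [mul_pow, mul_pow, hs, ht]; ring
end
end

section
/- Fix the D₄⁺ normal form f with a > 0 and let d₀(u,v) = ‖f(u,v)‖²/2 be the distance squared function with respect to the origin. Then all partial derivatives of d₀ at (0,0) of order ≤ 3 vanish, and the fourth-order Taylor polynomial of d₀ at (0,0) equals ((1+a²)/2)(u⁴ + v⁴) + (a² − 1)u²v². Moreover, writing this quartic as ((1+a²)/2)(u⁴ + α u²v² + v⁴) with α = 2(a² − 1)/(1 + a²), one has |α| < 2; in particular the quartic part is positive definite (so d₀ has an X₉-singularity at the origin). -/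
open Real Filter Topology

noncomputable section

/-- Smooth functions on the plane in the `k`-th power of the ideal `(u, v)`. -/
def MM : ∀ (_ : ℕ) {E : Type} [NormedAddCommGroup E] [NormedSpace ℝ E], (ℝ × ℝ → E) → Prop
  | 0, _, _, _, g => ContDiff ℝ (⊤ : ℕ∞) g
  | k + 1, E, _, _, g => ∃ h1 h2 : ℝ × ℝ → E, MM k h1 ∧ MM k h2 ∧
      g = fun p => p.1 • h1 p + p.2 • h2 p

section
variable {E F : Type} [NormedAddCommGroup E] [NormedSpace ℝ E]
  [NormedAddCommGroup F] [NormedSpace ℝ F]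

lemma MM.smooth {k : ℕ} : ∀ {g : ℝ × ℝ → E}, MM k g → ContDiff ℝ (⊤ : ℕ∞) g := by
  induction k with
  | zero => intro g h; exact h
  | succ k ih =>
    rintro g ⟨h1, h2, m1, m2, rfl⟩
    have := ih m1
    have := ih m2
    fun_prop

lemma MM.add {k : ℕ} : ∀ {g h : ℝ × ℝ → E}, MM k g → MM k h → MM k (fun p => g p + h p) := by
  induction k with
  | zero => intro g h hg hh; exact ContDiff.add hg hh
  | succ k ih =>
    rintro g h ⟨h1, h2, m1, m2, rfl⟩ ⟨l1, l2, n1, n2, rfl⟩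
    refine ⟨_, _, ih m1 n1, ih m2 n2, ?_⟩
    funext p
    simp only [smul_add]
    abel

lemma MM.clm {k : ℕ} (L : E →L[ℝ] F) : ∀ {g : ℝ × ℝ → E}, MM k g → MM k (fun p => L (g p)) := by
  induction k with
  | zero => intro g hg; exact L.contDiff.comp hg
  | succ k ih =>
    rintro g ⟨h1, h2, m1, m2, rfl⟩
    refine ⟨_, _, ih m1, ih m2, ?_⟩
    funext p
    simp

lemma MM.smul0 {k : ℕ} {s : ℝ × ℝ → ℝ} (hs : ContDiff ℝ (⊤ : ℕ∞) s) :
    ∀ {g : ℝ × ℝ → E}, MM k g → MM k (fun p => s p • g p) := by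
  induction k with
  | zero => intro g hg; exact ContDiff.smul hs hg
  | succ k ih =>
    rintro g ⟨h1, h2, m1, m2, rfl⟩
    refine ⟨_, _, ih m1, ih m2, ?_⟩
    funext p
    simp only [smul_add, smul_smul, mul_comm]

lemma MM.smul {j k : ℕ} {g : ℝ × ℝ → E} (hg : MM k g) :
    ∀ {s : ℝ × ℝ → ℝ}, MM j s → MM (j + k) (fun p => s p • g p) := by
  induction j with
  | zero => intro s hs; rw [zero_add]; exact hg.smul0 hs
  | succ k ih =>
    rintro s ⟨h1, h2, m1, m2, rfl⟩
    rw [Nat.add_right_comm]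
    refine ⟨_, _, ih m1, ih m2, ?_⟩
    funext p
    simp only [add_smul, smul_smul, smul_eq_mul]

lemma MM.mul {j k : ℕ} {s g : ℝ × ℝ → ℝ} (hs : MM j s) (hg : MM k g) :
    MM (j + k) (fun p => s p * g p) := hg.smul hs

lemma MM.down {k : ℕ} : ∀ {g : ℝ × ℝ → E}, MM (k + 1) g → MM k g := by
  induction k with
  | zero => intro g hg; exact hg.smooth
  | succ k ih =>
    rintro g ⟨h1, h2, m1, m2, rfl⟩
    exact ⟨_, _, ih m1, ih m2, rfl⟩

lemma MM.zero {k : ℕ} {g : ℝ × ℝ → E} (hg : MM (k + 1) g) : g 0 = 0 := by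
  obtain ⟨h1, h2, m1, m2, rfl⟩ := hg
  simp

lemma MM.fst : MM 1 (fun p : ℝ × ℝ => p.1) :=
  ⟨fun _ => 1, fun _ => 0, contDiff_const, contDiff_const, by funext p; simp⟩

lemma MM.snd : MM 1 (fun p : ℝ × ℝ => p.2) :=
  ⟨fun _ => 0, fun _ => 1, contDiff_const, contDiff_const, by funext p; simp⟩

lemma MM.fderiv {k : ℕ} : ∀ {g : ℝ × ℝ → E}, MM (k + 1) g → MM k (fun p => fderiv ℝ g p) := by
  induction k with
  | zero =>
    intro g hg
    exact hg.smooth.fderiv_right (m := ((⊤ : ℕ∞) : WithTop ℕ∞)) (by simp)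
  | succ k ih =>
    rintro g ⟨h1, h2, m1, m2, rfl⟩
    have e : (fun p => _root_.fderiv ℝ (fun p : ℝ × ℝ => p.1 • h1 p + p.2 • h2 p) p) =
        fun p => (p.1 • _root_.fderiv ℝ h1 p + p.2 • _root_.fderiv ℝ h2 p) +
         (ContinuousLinearMap.smulRightL ℝ (ℝ × ℝ) E (ContinuousLinearMap.fst ℝ ℝ ℝ) (h1 p) +
          ContinuousLinearMap.smulRightL ℝ (ℝ × ℝ) E (ContinuousLinearMap.snd ℝ ℝ ℝ) (h2 p)) := by
      funext p
      have d1 : HasFDerivAt h1 (_root_.fderiv ℝ h1 p) p :=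
        (m1.smooth.differentiable (by simp) p).hasFDerivAt
      have d2 : HasFDerivAt h2 (_root_.fderiv ℝ h2 p) p :=
        (m2.smooth.differentiable (by simp) p).hasFDerivAt
      have a1 := (hasFDerivAt_fst (𝕜 := ℝ) (p := p)).smul d1
      have a2 := (hasFDerivAt_snd (𝕜 := ℝ) (p := p)).smul d2
      refine (a1.add a2).fderiv.trans ?_
      ext <;> simp [add_comm, add_left_comm, add_assoc]
    rw [e]
    refine MM.add ⟨_, _, ih m1, ih m2, rfl⟩ (MM.add (MM.clm _ m1) (MM.clm _ m2))
end

lemma MM.iter {n : ℕ} : ∀ {k : ℕ} {E : Type} [NormedAddCommGroup E] [NormedSpace ℝ E]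
    {g : ℝ × ℝ → E}, MM k g → n < k → iteratedFDeriv ℝ n g 0 = 0 := by
  induction n with
  | zero =>
    intro k E _ _ g hg hk
    obtain ⟨k, rfl⟩ : ∃ m, k = m + 1 := ⟨k - 1, by omega⟩
    ext m
    simp [hg.zero]
  | succ n ih =>
    intro k E _ _ g hg hk
    obtain ⟨k, rfl⟩ : ∃ m, k = m + 1 := ⟨k - 1, by omega⟩
    rw [iteratedFDeriv_succ_eq_comp_right]
    have := ih hg.fderiv (by omega)
    simp only [Function.comp]
    have h2 : iteratedFDeriv ℝ n (_root_.fderiv ℝ g) 0 = 0 := this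
    rw [h2]
    exact LinearIsometryEquiv.map_zero (continuousMultilinearCurryRightEquiv' ℝ n (ℝ × ℝ) E).symm

lemma hasD1 {g : ℝ × ℝ → ℝ} (hg : ContDiff ℝ (⊤ : ℕ∞) g) (p : ℝ × ℝ) :
    HasDerivAt (fun u => g (u, p.2)) (fderiv ℝ g p (1, 0)) p.1 := by
  have d1 : HasFDerivAt g (fderiv ℝ g p) (p.1, p.2) :=
    (hg.differentiable (by simp) p).hasFDerivAt
  exact d1.comp_hasDerivAt p.1 ((hasDerivAt_id p.1).prodMk (hasDerivAt_const p.1 p.2))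

lemma hasD2 {g : ℝ × ℝ → ℝ} (hg : ContDiff ℝ (⊤ : ℕ∞) g) (p : ℝ × ℝ) :
    HasDerivAt (fun v => g (p.1, v)) (fderiv ℝ g p (0, 1)) p.2 := by
  have d1 : HasFDerivAt g (fderiv ℝ g p) (p.1, p.2) :=
    (hg.differentiable (by simp) p).hasFDerivAt
  exact d1.comp_hasDerivAt p.2 ((hasDerivAt_const p.2 p.1).prodMk (hasDerivAt_id p.2))

lemma step1 {k : ℕ} {g P : ℝ × ℝ → ℝ} (P' : ℝ × ℝ → ℝ)
    (h : ∃ R, MM (k + 1) R ∧ g = fun p => P p + R p)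
    (hP : ∀ u v, HasDerivAt (fun u => P (u, v)) (P' (u, v)) u) :
    ∃ R, MM k R ∧ pd1 g = fun p => P' p + R p := by
  obtain ⟨R, hR, rfl⟩ := h
  refine ⟨_, MM.clm (ContinuousLinearMap.apply ℝ ℝ ((1, 0) : ℝ × ℝ)) hR.fderiv, ?_⟩
  funext p
  exact ((hP p.1 p.2).add (hasD1 hR.smooth p)).deriv

lemma step2 {k : ℕ} {g P : ℝ × ℝ → ℝ} (P' : ℝ × ℝ → ℝ)
    (h : ∃ R, MM (k + 1) R ∧ g = fun p => P p + R p)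
    (hP : ∀ u v, HasDerivAt (fun v => P (u, v)) (P' (u, v)) v) :
    ∃ R, MM k R ∧ pd2 g = fun p => P' p + R p := by
  obtain ⟨R, hR, rfl⟩ := h
  refine ⟨_, MM.clm (ContinuousLinearMap.apply ℝ ℝ ((0, 1) : ℝ × ℝ)) hR.fderiv, ?_⟩
  funext p
  exact ((hP p.1 p.2).add (hasD2 hR.smooth p)).deriv

lemma fin0 {k : ℕ} {g P : ℝ × ℝ → ℝ} (h : ∃ R, MM (k + 1) R ∧ g = fun p => P p + R p) :
    g 0 = P 0 := by
  obtain ⟨R, hR, rfl⟩ := h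
  simp [hR.zero]

lemma polyD (c0 c1 c2 c3 c4 t : ℝ) :
    HasDerivAt (fun t : ℝ => c0 + c1 * t + c2 * t ^ 2 + c3 * t ^ 3 + c4 * t ^ 4)
      (c1 + 2 * c2 * t + 3 * c3 * t ^ 2 + 4 * c4 * t ^ 3) t := by
  have h1 := (hasDerivAt_id t).const_mul c1
  have h2 := (hasDerivAt_pow 2 t).const_mul c2
  have h3 := (hasDerivAt_pow 3 t).const_mul c3
  have h4 := (hasDerivAt_pow 4 t).const_mul c4
  refine HasDerivAt.congr_deriv (((((hasDerivAt_const t c0).add h1).add h2).add h3).add h4) ?_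
  push_cast
  ring

lemma polyD' {f : ℝ → ℝ} {d t : ℝ} (c0 c1 c2 c3 c4 : ℝ)
    (hf : ∀ t, f t = c0 + c1 * t + c2 * t ^ 2 + c3 * t ^ 3 + c4 * t ^ 4)
    (hd : d = c1 + 2 * c2 * t + 3 * c3 * t ^ 2 + 4 * c4 * t ^ 3) : HasDerivAt f d t := by
  rw [hd, funext hf]
  exact polyD c0 c1 c2 c3 c4 t

lemma MM_BC {g1 g3 : ℝ → ℝ} {g2 : ℝ × ℝ → ℝ} (h1 : ContDiff ℝ (⊤ : ℕ∞) g1)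
    (h3 : ContDiff ℝ (⊤ : ℕ∞) g3) (h2 : ContDiff ℝ (⊤ : ℕ∞) g2) : MM 3 (BC g1 g3 g2) := by
  have e1 : MM 0 (fun p : ℝ × ℝ => g1 p.1) := h1.comp contDiff_fst
  have e3 : MM 0 (fun p : ℝ × ℝ => g3 p.2) := h3.comp contDiff_snd
  have e2 : MM 0 (fun p : ℝ × ℝ => p.2 * g2 p) := contDiff_snd.mul h2
  have m1 := ((MM.fst.mul MM.fst).mul MM.fst).mul e1
  have m3 := ((MM.snd.mul MM.snd).mul MM.snd).mul e3
  have m2 := ((MM.fst.mul MM.fst).mul MM.snd).mul e2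
  have := (MM.add m1 m2).add m3
  convert this using 1
  funext p
  simp only [BC]
  ring

lemma dsq_dec (a : ℝ) (b1 b3 c1 c3 : ℝ → ℝ) (b2 c2 : ℝ × ℝ → ℝ)
    (hb1 : ContDiff ℝ (⊤ : ℕ∞) b1) (hb3 : ContDiff ℝ (⊤ : ℕ∞) b3)
    (hc1s : ContDiff ℝ (⊤ : ℕ∞) c1) (hc3s : ContDiff ℝ (⊤ : ℕ∞) c3)
    (hb2 : ContDiff ℝ (⊤ : ℕ∞) b2) (hc2 : ContDiff ℝ (⊤ : ℕ∞) c2) :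
    ∃ R, MM (4 + 1) R ∧ dsq (NF a b1 b3 c1 c3 b2 c2) 0 = fun p =>
      ((1 + a ^ 2) / 2 * (p.1 ^ 4 + p.2 ^ 4) + (a ^ 2 - 1) * p.1 ^ 2 * p.2 ^ 2) + R p := by
  have mB := MM_BC hb1 hb3 hb2
  have mC := MM_BC hc1s hc3s hc2
  have k0 : MM 0 (fun _ : ℝ × ℝ => a) := contDiff_const
  have k1 : MM 0 (fun _ : ℝ × ℝ => (1 / 2 : ℝ)) := contDiff_const
  have q := ((MM.fst.mul MM.fst).add (MM.snd.mul MM.snd)).mul (mB.mul k0)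
  have r := ((mB.mul mB).add (mC.mul mC)).mul k1
  refine ⟨_, q.add r.down, ?_⟩
  funext p
  simp [dsq, dot3, NF]
  ring

lemma quart_pos (a u v : ℝ) (ha : 0 < a) (h : (u, v) ≠ ((0, 0) : ℝ × ℝ)) :
    0 < (1 + a ^ 2) / 2 * (u ^ 4 + v ^ 4) + (a ^ 2 - 1) * u ^ 2 * v ^ 2 := by
  have e : (1 + a ^ 2) / 2 * (u ^ 4 + v ^ 4) + (a ^ 2 - 1) * u ^ 2 * v ^ 2 =
      (u ^ 2 - v ^ 2) ^ 2 / 2 + a ^ 2 * (u ^ 2 + v ^ 2) ^ 2 / 2 := by ring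
  have hp : 0 < u ^ 2 + v ^ 2 := by
    by_cases hu : u = 0
    · have hv : v ≠ 0 := by
        rintro rfl
        exact h (by rw [hu])
      positivity
    · positivity
  rw [e]
  positivity

/-- the distance squared function at the origin has an
`X₉`-singularity, with positive definite quartic part. -/
theorem stmt_18     (a : ℝ) (b1 b3 c1 c3 : ℝ → ℝ) (b2 c2 : ℝ × ℝ → ℝ)
    (hb1 : ContDiff ℝ (⊤ : ℕ∞) b1) (hb3 : ContDiff ℝ (⊤ : ℕ∞) b3)
    (hc1s : ContDiff ℝ (⊤ : ℕ∞) c1) (hc3s : ContDiff ℝ (⊤ : ℕ∞) c3)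
    (hb2 : ContDiff ℝ (⊤ : ℕ∞) b2) (hc2 : ContDiff ℝ (⊤ : ℕ∞) c2)
    (ha : 0 < a) :
    (∀ n : ℕ, n ≤ 3 →
      iteratedFDeriv ℝ n (dsq (NF a b1 b3 c1 c3 b2 c2) 0) 0 = 0) ∧
    pd1 (pd1 (pd1 (pd1 (dsq (NF a b1 b3 c1 c3 b2 c2) 0)))) 0 = 12 * (1 + a ^ 2) ∧
    pd2 (pd2 (pd2 (pd2 (dsq (NF a b1 b3 c1 c3 b2 c2) 0)))) 0 = 12 * (1 + a ^ 2) ∧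
    pd2 (pd2 (pd1 (pd1 (dsq (NF a b1 b3 c1 c3 b2 c2) 0)))) 0 = 4 * (a ^ 2 - 1) ∧
    pd2 (pd1 (pd1 (pd1 (dsq (NF a b1 b3 c1 c3 b2 c2) 0)))) 0 = 0 ∧
    pd2 (pd2 (pd2 (pd1 (dsq (NF a b1 b3 c1 c3 b2 c2) 0)))) 0 = 0 ∧
    |2 * (a ^ 2 - 1) / (1 + a ^ 2)| < 2 ∧
    (∀ u v : ℝ, (u, v) ≠ ((0, 0) : ℝ × ℝ) →
      0 < (1 + a ^ 2) / 2 * (u ^ 4 + v ^ 4) + (a ^ 2 - 1) * u ^ 2 * v ^ 2) := by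
  have D := dsq_dec a b1 b3 c1 c3 b2 c2 hb1 hb3 hc1s hc3s hb2 hc2
  generalize dsq (NF a b1 b3 c1 c3 b2 c2) 0 = d at D
  have D1 := step1 (fun p => 2 * (1 + a ^ 2) * p.1 ^ 3 + 2 * (a ^ 2 - 1) * p.1 * p.2 ^ 2) D
    (fun u v => polyD' ((1 + a ^ 2) / 2 * v ^ 4) 0 ((a ^ 2 - 1) * v ^ 2) 0 ((1 + a ^ 2) / 2)
      (fun t => by ring) (by ring))
  have D11 := step1 (fun p => 6 * (1 + a ^ 2) * p.1 ^ 2 + 2 * (a ^ 2 - 1) * p.2 ^ 2) D1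
    (fun u v => polyD' 0 (2 * (a ^ 2 - 1) * v ^ 2) 0 (2 * (1 + a ^ 2)) 0
      (fun t => by ring) (by ring))
  have D111 := step1 (fun p => 12 * (1 + a ^ 2) * p.1) D11
    (fun u v => polyD' (2 * (a ^ 2 - 1) * v ^ 2) 0 (6 * (1 + a ^ 2)) 0 0
      (fun t => by ring) (by ring))
  have D2 := step2 (fun p => 2 * (1 + a ^ 2) * p.2 ^ 3 + 2 * (a ^ 2 - 1) * p.1 ^ 2 * p.2) D
    (fun u v => polyD' ((1 + a ^ 2) / 2 * u ^ 4) 0 ((a ^ 2 - 1) * u ^ 2) 0 ((1 + a ^ 2) / 2)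
      (fun t => by ring) (by ring))
  have D22 := step2 (fun p => 6 * (1 + a ^ 2) * p.2 ^ 2 + 2 * (a ^ 2 - 1) * p.1 ^ 2) D2
    (fun u v => polyD' 0 (2 * (a ^ 2 - 1) * u ^ 2) 0 (2 * (1 + a ^ 2)) 0
      (fun t => by ring) (by ring))
  have D222 := step2 (fun p => 12 * (1 + a ^ 2) * p.2) D22
    (fun u v => polyD' (2 * (a ^ 2 - 1) * u ^ 2) 0 (6 * (1 + a ^ 2)) 0 0
      (fun t => by ring) (by ring))
  have D112 := step2 (fun p => 4 * (a ^ 2 - 1) * p.2) D11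
    (fun u v => polyD' (6 * (1 + a ^ 2) * u ^ 2) 0 (2 * (a ^ 2 - 1)) 0 0
      (fun t => by ring) (by ring))
  have D12 := step2 (fun p => 4 * (a ^ 2 - 1) * p.1 * p.2) D1
    (fun u v => polyD' (2 * (1 + a ^ 2) * u ^ 3) 0 (2 * (a ^ 2 - 1) * u) 0 0
      (fun t => by ring) (by ring))
  have D122 := step2 (fun p => 4 * (a ^ 2 - 1) * p.1) D12
    (fun u v => polyD' 0 (4 * (a ^ 2 - 1) * u) 0 0 0
      (fun t => by ring) (by ring))
  refine ⟨?_, ?_, ?_, ?_, ?_, ?_, ?_, fun u v h => quart_pos a u v ha h⟩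
  · intro n hn
    obtain ⟨R, hR, rfl⟩ := D
    have k0 : MM 0 (fun _ : ℝ × ℝ => (1 + a ^ 2) / 2) := contDiff_const
    have k1 : MM 0 (fun _ : ℝ × ℝ => a ^ 2 - 1) := contDiff_const
    have uu := MM.fst.mul MM.fst
    have vv := MM.snd.mul MM.snd
    have q : MM 4 _ := ((((uu.mul uu).add (vv.mul vv)).mul k0).add ((uu.mul vv).mul k1)).add hR.down
    refine MM.iter (k := 4) ?_ (by omega)
    convert q using 1
    funext p
    ring
  · exact fin0 (k := 0) (step1 (fun p => 12 * (1 + a ^ 2)) D111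
      (fun u v => polyD' 0 (12 * (1 + a ^ 2)) 0 0 0 (fun t => by ring) (by ring)))
  · exact fin0 (k := 0) (step2 (fun p => 12 * (1 + a ^ 2)) D222
      (fun u v => polyD' 0 (12 * (1 + a ^ 2)) 0 0 0 (fun t => by ring) (by ring)))
  · exact fin0 (k := 0) (step2 (fun p => 4 * (a ^ 2 - 1)) D112
      (fun u v => polyD' 0 (4 * (a ^ 2 - 1)) 0 0 0 (fun t => by ring) (by ring)))
  · exact fin0 (k := 0) (step2 (fun p => 0) D111
      (fun u v => polyD' (12 * (1 + a ^ 2) * u) 0 0 0 0 (fun t => by ring) (by ring)))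
  · exact fin0 (k := 0) (step2 (fun p => 0) D122
      (fun u v => polyD' (4 * (a ^ 2 - 1) * u) 0 0 0 0 (fun t => by ring) (by ring)))
  · have : 0 < 1 + a ^ 2 := by positivity
    have h2 : 0 < a ^ 2 := by positivity
    rw [abs_lt, lt_div_iff₀ this, div_lt_iff₀ this]
    constructor <;> nlinarith
end
end

section
/- Fix the D₄⁺ normal form f with a > 0. Let r, θ : [0,ε) → ℝ be C^∞ functions with r(0) = 0 and r′(0) > 0, and define the curve γ(t) = r(t)·(cos θ(t), sin θ(t)) in ℝ². Then for all sufficiently small t > 0 the derivative (f∘γ)′(t) is nonzero, and the unit tangent vector has a limit as t → 0⁺: lim_{t→0⁺} (f∘γ)′(t)/‖(f∘γ)′(t)‖ = (cos 2θ(0), a, 0)/√(cos²2θ(0) + a²). In particular, every curve emanating from the D₄⁺-singular point with nonvanishing initial radial speed has a well-defined initial tangent direction on the image. -/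
open Real Filter Topology

noncomputable section

/-- The image under the normal form of a curve emanating from the origin with
radial parameterization `γ(t) = r(t)(cos θ(t), sin θ(t))`. -/
def curveNF (a : ℝ) (b1 b3 c1 c3 : ℝ → ℝ) (b2 c2 : ℝ × ℝ → ℝ) (r θ : ℝ → ℝ) (t : ℝ) :
    Fin 3 → ℝ :=
  NF a b1 b3 c1 c3 b2 c2 (r t * Real.cos (θ t), r t * Real.sin (θ t))

theorem auxA {E : Type*} [NormedAddCommGroup E] [NormedSpace ℝ E] (g : ℝ → E) (ε : ℝ)
    (hε : 0 < ε) (hg : ContDiffOn ℝ (⊤ : ℕ∞) g (Set.Ico 0 ε)) :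
    Tendsto g (𝓝[>] 0) (𝓝 (g 0)) ∧
    Tendsto (deriv g) (𝓝[>] 0) (𝓝 (derivWithin g (Set.Ici 0) 0)) ∧
    (∀ t ∈ Set.Ioo 0 ε, DifferentiableAt ℝ g t) ∧
    HasDerivWithinAt g (derivWithin g (Set.Ici 0) 0) (Set.Ici 0) 0 := by
  have h0 : (0:ℝ) ∈ Set.Ico 0 ε := ⟨le_refl _, hε⟩
  have hle : 𝓝[>] (0:ℝ) ≤ 𝓝[Set.Ico 0 ε] 0 := by
    rw [← nhdsWithin_Ioo_eq_nhdsGT hε]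
    exact nhdsWithin_mono _ Set.Ioo_subset_Ico_self
  have hset : (Set.Ico 0 ε) =ᶠ[𝓝 (0:ℝ)] Set.Ici 0 := by
    filter_upwards [Iio_mem_nhds hε] with x hx
    apply propext
    exact ⟨fun h => h.1, fun h => ⟨h, hx⟩⟩
  have hd : derivWithin g (Set.Ico 0 ε) 0 = derivWithin g (Set.Ici 0) 0 :=
    derivWithin_congr_set hset
  have hc := hg.continuousOn_derivWithin (uniqueDiffOn_Ico 0 ε) (by simp)
  have hdiff := hg.differentiableOn (by simp)
  refine ⟨(hg.continuousOn 0 h0).mono_left hle, ?_, ?_, ?_⟩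
  · rw [← hd]
    refine ((hc 0 h0).mono_left hle).congr' ?_
    filter_upwards [Ioo_mem_nhdsGT hε] with t ht
    exact derivWithin_of_mem_nhds (Ico_mem_nhds ht.1 ht.2)
  · intro t ht
    exact (hdiff t ⟨ht.1.le, ht.2⟩).differentiableAt (Ico_mem_nhds ht.1 ht.2)
  · rw [← hd]
    exact (hasDerivWithinAt_congr_set hset).1 (hdiff 0 h0).hasDerivWithinAt

theorem norm3_smul (c : ℝ) (hc : 0 ≤ c) (x : Fin 3 → ℝ) : norm3 (c • x) = c * norm3 x := by
  have : dot3 (c • x) (c • x) = c ^ 2 * dot3 x x := by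
    simp [dot3]; ring
  rw [norm3, this, Real.sqrt_mul (sq_nonneg c), Real.sqrt_sq hc, norm3]

theorem norm3_normalize (c : ℝ) (hc : 0 < c) (x : Fin 3 → ℝ) :
    (norm3 (c • x))⁻¹ • (c • x) = (norm3 x)⁻¹ • x := by
  rw [norm3_smul c hc.le, smul_smul, mul_inv]
  congr 1
  field_simp

theorem continuous_norm3 : Continuous norm3 := by
  unfold norm3 dot3
  fun_prop

def BB (g1 g3 : ℝ → ℝ) (g2 : ℝ × ℝ → ℝ) (r θ : ℝ → ℝ) (t : ℝ) : ℝ :=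
  cos (θ t) ^ 3 * g1 (r t * cos (θ t)) +
    r t * cos (θ t) ^ 2 * sin (θ t) ^ 2 * g2 (r t * cos (θ t), r t * sin (θ t)) +
    sin (θ t) ^ 3 * g3 (r t * sin (θ t))

theorem contDiffOn_BB (g1 g3 : ℝ → ℝ) (g2 : ℝ × ℝ → ℝ) (r θ : ℝ → ℝ) (s : Set ℝ)
    (h1 : ContDiff ℝ (⊤ : ℕ∞) g1) (h3 : ContDiff ℝ (⊤ : ℕ∞) g3) (h2 : ContDiff ℝ (⊤ : ℕ∞) g2)
    (hr : ContDiffOn ℝ (⊤ : ℕ∞) r s) (hθ : ContDiffOn ℝ (⊤ : ℕ∞) θ s) :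
    ContDiffOn ℝ (⊤ : ℕ∞) (BB g1 g3 g2 r θ) s := by
  have hcos := hθ.cos
  have hsin := hθ.sin
  have hu := hr.mul hcos
  have hv := hr.mul hsin
  have e1 := h1.comp_contDiffOn hu
  have e3 := h3.comp_contDiffOn hv
  have e2 := h2.comp_contDiffOn (hu.prodMk hv)
  exact (((hcos.pow 3).mul e1).add (((hr.mul (hcos.pow 2)).mul (hsin.pow 2)).mul e2)).add
    ((hsin.pow 3).mul e3)

def GG (a : ℝ) (b1 b3 c1 c3 : ℝ → ℝ) (b2 c2 : ℝ × ℝ → ℝ) (r θ : ℝ → ℝ) (t : ℝ) : Fin 3 → ℝ :=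
  ![cos (2 * θ t), a + r t * BB b1 b3 b2 r θ t, r t * BB c1 c3 c2 r θ t]

theorem curve_eq (a : ℝ) (b1 b3 c1 c3 : ℝ → ℝ) (b2 c2 : ℝ × ℝ → ℝ) (r θ : ℝ → ℝ) :
    curveNF a b1 b3 c1 c3 b2 c2 r θ = fun t => (r t) ^ 2 • GG a b1 b3 c1 c3 b2 c2 r θ t := by
  funext t
  have h := sin_sq_add_cos_sq (θ t)
  ext i
  fin_cases i
  · simp [curveNF, NF, GG, cos_two_mul]
    linear_combination (-(r t)^2) * h
  · simp [curveNF, NF, GG, BC, BB]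
    linear_combination (a * (r t)^2) * h
  · simp [curveNF, NF, GG, BC, BB]
    ring

/-- every curve emanating from the `D₄⁺`-singular point with
nonvanishing initial radial speed has a well-defined initial tangent direction. -/
theorem stmt_19     (a : ℝ) (b1 b3 c1 c3 : ℝ → ℝ) (b2 c2 : ℝ × ℝ → ℝ)
    (hb1 : ContDiff ℝ (⊤ : ℕ∞) b1) (hb3 : ContDiff ℝ (⊤ : ℕ∞) b3)
    (hc1s : ContDiff ℝ (⊤ : ℕ∞) c1) (hc3s : ContDiff ℝ (⊤ : ℕ∞) c3)
    (hb2 : ContDiff ℝ (⊤ : ℕ∞) b2) (hc2 : ContDiff ℝ (⊤ : ℕ∞) c2)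
    (ha : 0 < a) (ε : ℝ) (hε : 0 < ε) (r θ : ℝ → ℝ)
    (hr : ContDiffOn ℝ (⊤ : ℕ∞) r (Set.Ico 0 ε)) (hθ : ContDiffOn ℝ (⊤ : ℕ∞) θ (Set.Ico 0 ε))
    (hr0 : r 0 = 0) (hr' : 0 < derivWithin r (Set.Ici 0) 0) :
    (∃ δ : ℝ, 0 < δ ∧ δ ≤ ε ∧ ∀ t : ℝ, 0 < t → t < δ →
      deriv (curveNF a b1 b3 c1 c3 b2 c2 r θ) t ≠ 0) ∧
    Filter.Tendsto
      (fun t : ℝ => (norm3 (deriv (curveNF a b1 b3 c1 c3 b2 c2 r θ) t))⁻¹ •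
        deriv (curveNF a b1 b3 c1 c3 b2 c2 r θ) t)
      (𝓝[>] (0 : ℝ))
      (𝓝 ((Real.sqrt (Real.cos (2 * θ 0) ^ 2 + a ^ 2))⁻¹ •
        ![Real.cos (2 * θ 0), a, 0])) := by
  obtain ⟨r1, r2, r3, r4⟩ := auxA r ε hε hr
  have hG : ContDiffOn ℝ (⊤ : ℕ∞) (GG a b1 b3 c1 c3 b2 c2 r θ) (Set.Ico 0 ε) := by
    rw [contDiffOn_pi]
    intro i
    fin_cases i
    · exact (contDiffOn_const.mul hθ).cos
    · exact contDiffOn_const.add (hr.mul (contDiffOn_BB b1 b3 b2 r θ _ hb1 hb3 hb2 hr hθ))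
    · exact hr.mul (contDiffOn_BB c1 c3 c2 r θ _ hc1s hc3s hc2 hr hθ)
  obtain ⟨G1, G2, G3, -⟩ := auxA _ ε hε hG
  set G := GG a b1 b3 c1 c3 b2 c2 r θ with hGdef
  have hG0 : G 0 = ![Real.cos (2 * θ 0), a, 0] := by
    simp [hGdef, GG, hr0]
  set ρ := derivWithin r (Set.Ici 0) 0 with hρ
  have hpos : ∀ᶠ t in 𝓝[>] (0:ℝ), 0 < r t := by
    have hs := (hasDerivWithinAt_iff_tendsto_slope' (by simp)).1 (r4.mono Set.Ioi_subset_Ici_self)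
    filter_upwards [hs.eventually (lt_mem_nhds hr'), self_mem_nhdsWithin] with t ht ht0
    have ht0' : (0:ℝ) < t := ht0
    rw [slope_def_field, hr0, sub_zero, sub_zero] at ht
    exact (div_pos_iff_of_pos_right ht0').1 ht
  have hderiv : ∀ᶠ t in 𝓝[>] (0:ℝ), deriv (curveNF a b1 b3 c1 c3 b2 c2 r θ) t =
      r t • ((2 * deriv r t) • G t + r t • deriv G t) := by
    filter_upwards [Ioo_mem_nhdsGT hε] with t ht
    rw [curve_eq]
    have h1 := ((r3 t ht).hasDerivAt.pow 2).smul (G3 t ht).hasDerivAt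
    refine h1.deriv.trans ?_
    ext i
    simp
    ring
  have hlim : Tendsto (fun t => (2 * deriv r t) • G t + r t • deriv G t) (𝓝[>] 0)
      (𝓝 ((2 * ρ) • G 0)) := by
    have := ((r2.const_mul 2).smul G1).add (r1.smul G2)
    rw [hr0, zero_smul, add_zero] at this
    exact this
  have hn : norm3 (G 0) = Real.sqrt (Real.cos (2 * θ 0) ^ 2 + a ^ 2) := by
    rw [hG0]; simp [norm3, dot3, sq]
  have hnpos : 0 < norm3 (G 0) := by
    rw [hn]; positivity
  have hVpos : 0 < norm3 ((2 * ρ) • G 0) := by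
    rw [norm3_smul _ (by positivity)]; positivity
  have hnlim := (continuous_norm3.tendsto _).comp hlim
  constructor
  · have hev : ∀ᶠ t in 𝓝[>] (0:ℝ), deriv (curveNF a b1 b3 c1 c3 b2 c2 r θ) t ≠ 0 := by
      filter_upwards [hpos, hderiv, hnlim.eventually (lt_mem_nhds hVpos)] with t h1 h2 h3 h4
      rw [h2] at h4
      have h5 := (smul_eq_zero.1 h4).resolve_left h1.ne'
      simp only [Function.comp_apply] at h3
      rw [h5] at h3
      simp [norm3, dot3] at h3
    obtain ⟨δ, hδ, hsub⟩ := mem_nhdsGT_iff_exists_Ioo_subset.1 hev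
    refine ⟨min δ ε, lt_min hδ hε, min_le_right _ _, fun t h1 h2 => ?_⟩
    exact hsub ⟨h1, h2.trans_le (min_le_left _ _)⟩
  · rw [← hn, ← hG0, ← norm3_normalize (2 * ρ) (by positivity)]
    refine ((hnlim.inv₀ hVpos.ne').smul hlim).congr' ?_
    filter_upwards [hpos, hderiv] with t h1 h2
    rw [h2, norm3_normalize _ h1]
    rfl
end
end
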